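/- arXiv:2303.10682 — 6 statements merged into one kernel-verified Lean document; each statement's English description precedes it below -/
import Mathlib

section
/- Let p > 2 be a prime with p ≤ n, and write n = (p−1) + n_1 and n_1 = p·n_2 + r with 0 ≤ r < p. For every tableau t in the p-class [t_n] of the one-column standard tableau t_n, the numbers 1, …, p−1 all lie in the first column of t, and each of the consecutive blocks B_1 = {p, …, 2p−1}, B_2 = {2p, …, 3p−1}, …, B_{n_2} (each of size p), as well as the final block of size r when r > 0, lies entirely in a single column of t. Moreover, the map f_1 sending t to the two-column standard tableau of size n_2 having i in its first column exactly when B_i lies in the first column of t is a bijection [t_n] → Std(Par^{≤2}_{n_2}) when r = 0; and when r > 0, the map f_2 sending t to (f_1(t restricted to 1..n−r), 1 or 2 according as the final block lies in the first or second column of t) is a bijection [t_n] → Std(Par^{≤2}_{n_2}) × {1, 2}. -/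
/-- A two-column standard Young tableau of size `n`, encoded by the function
`col : Fin n → Fin 2` recording the column (`0` = first, `1` = second) containing
the entry `j+1`, subject to the ballot (lattice word) condition, which is
equivalent to standardness. -/
structure TwoColTab (n : ℕ) where
  col : Fin n → Fin 2
  ballot : ∀ m : Fin n,
    (Finset.univ.filter fun i : Fin n => i ≤ m ∧ col i = 1).card ≤
    (Finset.univ.filter fun i : Fin n => i ≤ m ∧ col i = 0).card

theorem TwoColTab.ext' {n : ℕ} : ∀ {s t : TwoColTab n}, s.col = t.col → s = t
  | ⟨a, _⟩, ⟨b, _⟩, h => by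
      obtain rfl : a = b := h
      rfl

noncomputable instance (n : ℕ) : Fintype (TwoColTab n) :=
  Fintype.ofInjective TwoColTab.col (fun _ _ h => TwoColTab.ext' h)

/-- The content `c_t(j+1) = (column of j+1) − (row of j+1)` of the entry `j+1`,
computed from the column word `c`: if `j+1` lies in column `k ∈ {1,2}` then its row
is the number of `i ≤ j+1` lying in column `k`, and its content is `k − row`. -/
def colContent {n : ℕ} (c : Fin n → Fin 2) (j : Fin n) : ℤ :=
  if c j = 0 then
    1 - ((Finset.univ.filter fun i : Fin n => i ≤ j ∧ c i = 0).card : ℤ)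
  else
    2 - ((Finset.univ.filter fun i : Fin n => i ≤ j ∧ c i = 1).card : ℤ)

/-- The content function of a two-column standard tableau. -/
def tabContent {n : ℕ} (t : TwoColTab n) (j : Fin n) : ℤ := colContent t.col j

/-- Membership in the `p`-class of the one-column standard tableau `t_n`
(whose content at the entry `j+1` is `−j`), expressed on column words. -/
def inOneColClass (p n : ℕ) (c : Fin n → Fin 2) : Prop :=
  ∀ j : Fin n, ((colContent c j : ℤ) : ZMod p) = ((-(j.val : ℤ) : ℤ) : ZMod p)

/-- Two tableaux are in the same `p`-class if their contents agree modulo `p`. -/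
def pClassEq (p n : ℕ) (s t : TwoColTab n) : Prop :=
  ∀ j : Fin n, ((tabContent s j : ℤ) : ZMod p) = ((tabContent t j : ℤ) : ZMod p)

/-- The one-column standard tableau `t_n`. -/
def oneColTab (n : ℕ) : TwoColTab n :=
  ⟨fun _ => 0, by intro m; simp⟩

/-- Arithmetic bound: the entries of the `b`-th block `B_{b+1}` fit inside `Fin n`. -/
theorem blockLt {p n n1 n2 r : ℕ} (hp : 0 < p) (hn : n = (p - 1) + n1)
    (hn1 : n1 = p * n2 + r) {b : ℕ} (hb : b < n2) : p - 1 + b * p < n := by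
  have h2 : b * p + p ≤ p * n2 := by
    calc b * p + p = (b + 1) * p := by ring
    _ ≤ n2 * p := Nat.mul_le_mul_right p hb
    _ = p * n2 := Nat.mul_comm _ _
  calc p - 1 + b * p < p - 1 + (b * p + p) := by omega
  _ ≤ p - 1 + p * n2 := Nat.add_le_add_left h2 _
  _ ≤ p - 1 + (p * n2 + r) := by omega
  _ = n := by rw [hn, hn1]

/-- Arithmetic bound: when `r > 0` the first entry of the final block fits inside `Fin n`. -/
theorem lastBlockLt {p n n1 n2 r : ℕ} (hn : n = (p - 1) + n1)
    (hn1 : n1 = p * n2 + r) (hr0 : 0 < r) : p - 1 + n2 * p < n := by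
  calc p - 1 + n2 * p = p - 1 + p * n2 := by rw [Nat.mul_comm]
  _ < p - 1 + (p * n2 + r) := by omega
  _ = n := by rw [hn, hn1]

/-- The word whose first `p - 1` letters are `0`, followed by `p` copies of each letter of `v`. -/
def blockWord (p : ℕ) (v : ℕ → Fin 2) (i : ℕ) : Fin 2 :=
  if i < p - 1 then 0 else v ((i - (p - 1)) / p)

/-- The extension of a finite column word by `0`. -/
def extendWord {n : ℕ} (c : Fin n → Fin 2) (i : ℕ) : Fin 2 :=
  if h : i < n then c ⟨i, h⟩ else 0

theorem extendWord_val {n : ℕ} (c : Fin n → Fin 2) (i : Fin n) : extendWord c i = c i := by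
  simp [extendWord]

theorem Fin.two_eq_zero_or_one (a : Fin 2) : a = 0 ∨ a = 1 := by
  fin_cases a <;> simp

theorem card_filter_eq_count {n : ℕ} {c : Fin n → Fin 2} {w : ℕ → Fin 2}
    (h : ∀ i : Fin n, c i = w i) (j : Fin n) (k : Fin 2) :
    (Finset.univ.filter fun i : Fin n => i ≤ j ∧ c i = k).card =
      Nat.count (fun i => w i = k) (j + 1) := by
  rw [Nat.count_eq_card_filter_range]
  refine Finset.card_bij (fun i _ => i.val) ?_ (fun a _ b _ hab => Fin.ext hab) ?_
  · intro a ha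
    simp only [Finset.mem_filter, Finset.mem_univ, true_and, Fin.le_def] at ha
    simp only [Finset.mem_filter, Finset.mem_range, ← h]
    exact ⟨by omega, ha.2⟩
  · intro b hb
    simp only [Finset.mem_filter, Finset.mem_range] at hb
    have hj := j.isLt
    refine ⟨⟨b, by omega⟩, ?_, rfl⟩
    simp only [Finset.mem_filter, Finset.mem_univ, true_and, Fin.le_def, h]
    exact ⟨by omega, hb.2⟩

theorem count_zero_add_count_one (w : ℕ → Fin 2) (m : ℕ) :
    Nat.count (fun i => w i = 0) m + Nat.count (fun i => w i = 1) m = m := by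
  induction m with
  | zero => simp
  | succ m ih =>
    rcases Fin.two_eq_zero_or_one (w m) with h | h <;> simp [Nat.count_succ, h] <;> omega

theorem count_congr_of_lt {w w' : ℕ → Fin 2} {m : ℕ} (h : ∀ i < m, w i = w' i) (k : Fin 2) :
    Nat.count (fun i => w i = k) m = Nat.count (fun i => w' i = k) m := by
  simp only [Nat.count_eq_card_filter_range]
  congr 1
  refine Finset.filter_congr fun i hi => ?_
  rw [h i (Finset.mem_range.1 hi)]

theorem ballot_iff_count {n : ℕ} {c : Fin n → Fin 2} {w : ℕ → Fin 2}
    (h : ∀ i : Fin n, c i = w i) :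
    (∀ m : Fin n, (Finset.univ.filter fun i : Fin n => i ≤ m ∧ c i = 1).card ≤
      (Finset.univ.filter fun i : Fin n => i ≤ m ∧ c i = 0).card) ↔
    ∀ m ≤ n, Nat.count (fun i => w i = 1) m ≤ Nat.count (fun i => w i = 0) m := by
  simp only [card_filter_eq_count h]
  constructor
  · intro H m hm
    cases m with
    | zero => simp
    | succ m => exact H ⟨m, hm⟩
  · exact fun H m => H (m + 1) m.isLt

/-- Membership in the `p`-class of the one-column tableau as a condition on letter counts. -/
theorem inOneColClass_iff_count {p n : ℕ} {c : Fin n → Fin 2} {w : ℕ → Fin 2}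
    (h : ∀ i : Fin n, c i = w i) :
    inOneColClass p n c ↔ ∀ j < n, (w j = 0 → p ∣ Nat.count (fun i => w i = 1) j) ∧
      (w j = 1 → p ∣ Nat.count (fun i => w i = 0) j + 1) := by
  have key : ∀ j : Fin n, ((colContent c j : ℤ) : ZMod p) = ((-(j.val : ℤ) : ℤ) : ZMod p) ↔
      (w j = 0 → p ∣ Nat.count (fun i => w i = 1) j) ∧
      (w j = 1 → p ∣ Nat.count (fun i => w i = 0) j + 1) := by
    intro j
    have hs := count_zero_add_count_one w j
    rw [ZMod.intCast_eq_intCast_iff_dvd_sub, ← dvd_neg]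
    rcases Fin.two_eq_zero_or_one (w j) with hj | hj
    · have e : -(-(j.val : ℤ) - colContent c j) =
          ((Nat.count (fun i => w i = 1) j : ℕ) : ℤ) := by
        simp only [colContent, card_filter_eq_count h, h j, Nat.count_succ, hj, if_true]
        push_cast
        omega
      rw [e, Int.natCast_dvd_natCast]
      simp [hj]
    · have e : -(-(j.val : ℤ) - colContent c j) =
          ((Nat.count (fun i => w i = 0) j + 1 : ℕ) : ℤ) := by
        simp only [colContent, card_filter_eq_count h, h j, Nat.count_succ, hj, one_ne_zero,
          if_true, if_false]
        push_cast
        omega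
      rw [e, Int.natCast_dvd_natCast]
      simp [hj]
  exact ⟨fun H j hj => (key ⟨j, hj⟩).1 (H ⟨j, hj⟩), fun H j => (key j).2 (H j j.isLt)⟩

theorem blockWord_of_lt {p : ℕ} (v : ℕ → Fin 2) {i : ℕ} (hi : i < p - 1) :
    blockWord p v i = 0 := if_pos hi

theorem blockWord_block {p : ℕ} (v : ℕ → Fin 2) (b : ℕ) {s : ℕ} (hs : s < p) :
    blockWord p v (p - 1 + b * p + s) = v b := by
  have h1 : ¬ p - 1 + b * p + s < p - 1 := by omega
  have h2 : p - 1 + b * p + s - (p - 1) = s + b * p := by omega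
  rw [blockWord, if_neg h1, h2, Nat.add_mul_div_right _ _ (by omega), Nat.div_eq_of_lt hs,
    Nat.zero_add]

/-- A position is either among the first `p - 1` ones or at some offset inside a block. -/
theorem lt_or_exists_block {p : ℕ} (hp : 0 < p) (m : ℕ) :
    m < p - 1 ∨ ∃ b s, s < p ∧ m = p - 1 + b * p + s := by
  rcases lt_or_ge m (p - 1) with h | h
  · exact Or.inl h
  · refine Or.inr ⟨(m - (p - 1)) / p, (m - (p - 1)) % p, Nat.mod_lt _ hp, ?_⟩
    have := Nat.div_add_mod' (m - (p - 1)) p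
    omega

theorem count_blockWord_of_le {p : ℕ} (v : ℕ → Fin 2) (k : Fin 2) {m : ℕ} (hm : m ≤ p - 1) :
    Nat.count (fun i => blockWord p v i = k) m = if k = 0 then m else 0 := by
  induction m with
  | zero => simp
  | succ m ih =>
    rw [Nat.count_succ, ih (by omega), blockWord_of_lt v (by omega)]
    rcases Fin.two_eq_zero_or_one k with rfl | rfl <;> simp

theorem count_blockWord_block {p : ℕ} (v : ℕ → Fin 2) (k : Fin 2) (b : ℕ) {s : ℕ} (hs : s ≤ p) :
    Nat.count (fun i => blockWord p v i = k) (p - 1 + b * p + s) =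
      (if k = 0 then p - 1 else 0) + Nat.count (fun i => v i = k) b * p +
        if v b = k then s else 0 := by
  induction b generalizing s with
  | zero =>
    induction s with
    | zero => simp [count_blockWord_of_le]
    | succ s ih =>
      rw [← Nat.add_assoc, Nat.count_succ, ih (by omega), blockWord_block v 0 (by omega)]
      split_ifs <;> omega
  | succ b ihb =>
    induction s with
    | zero =>
      have e : p - 1 + (b + 1) * p + 0 = p - 1 + b * p + p := by ring
      rw [e, ihb le_rfl, Nat.count_succ, Nat.add_mul]
      split_ifs <;> omega
    | succ s ih =>
      rw [← Nat.add_assoc, Nat.count_succ, ih (by omega), blockWord_block v (b + 1) (by omega)]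
      split_ifs <;> omega

theorem blockWord_dvd_count {p : ℕ} (hp : 0 < p) (v : ℕ → Fin 2) (j : ℕ) :
    (blockWord p v j = 0 → p ∣ Nat.count (fun i => blockWord p v i = 1) j) ∧
      (blockWord p v j = 1 → p ∣ Nat.count (fun i => blockWord p v i = 0) j + 1) := by
  rcases lt_or_exists_block hp j with h | ⟨b, s, hs, rfl⟩
  · simp [blockWord_of_lt v h, count_blockWord_of_le v 1 h.le]
  · rw [blockWord_block v b hs, count_blockWord_block v 1 b hs.le,
      count_blockWord_block v 0 b hs.le]
    refine ⟨fun h => by simp [h], fun h => ⟨1 + Nat.count (fun i => v i = 0) b, ?_⟩⟩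
    simp only [h, if_true, one_ne_zero, if_false, Nat.mul_comm p, Nat.add_mul]
    omega

theorem blockWord_ballot {p N : ℕ} (hp : 0 < p) {v : ℕ → Fin 2}
    (hv : ∀ b ≤ N, Nat.count (fun i => v i = 1) b ≤ Nat.count (fun i => v i = 0) b)
    {m : ℕ} (hm : m < p - 1 + N * p + p) :
    Nat.count (fun i => blockWord p v i = 1) m ≤ Nat.count (fun i => blockWord p v i = 0) m := by
  rcases lt_or_exists_block hp m with h | ⟨b, s, hs, rfl⟩
  · simp [count_blockWord_of_le v _ h.le]
  · have hb : b ≤ N := by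
      by_contra! hlt
      have := Nat.mul_le_mul_right p (Nat.succ_le_of_lt hlt)
      rw [Nat.succ_mul] at this
      omega
    have := Nat.mul_le_mul_right p (hv b hb)
    rw [count_blockWord_block v 1 b hs.le, count_blockWord_block v 0 b hs.le]
    simp only [if_true, one_ne_zero, if_false]
    split_ifs <;> omega

theorem ballot_of_blockWord_ballot {p : ℕ} (hp : 0 < p) {v : ℕ → Fin 2} {b : ℕ}
    (h : Nat.count (fun i => blockWord p v i = 1) (p - 1 + b * p) ≤
      Nat.count (fun i => blockWord p v i = 0) (p - 1 + b * p)) :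
    Nat.count (fun i => v i = 1) b ≤ Nat.count (fun i => v i = 0) b := by
  have h1 := count_blockWord_block v 1 b (Nat.zero_le p)
  have h0 := count_blockWord_block v 0 b (Nat.zero_le p)
  simp only [if_true, one_ne_zero, if_false, Nat.add_zero, ite_self] at h1 h0
  rw [h1, h0] at h
  by_contra! hlt
  have := Nat.mul_le_mul_right p (Nat.succ_le_of_lt hlt)
  rw [Nat.succ_mul] at this
  omega

/-- A word whose contents are those of the one-column class is determined by its letters at
the starts of the blocks. -/
theorem eq_blockWord {p n : ℕ} (hp : 0 < p) {w : ℕ → Fin 2}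
    (hw : ∀ j < n, (w j = 0 → p ∣ Nat.count (fun i => w i = 1) j) ∧
      (w j = 1 → p ∣ Nat.count (fun i => w i = 0) j + 1)) :
    ∀ m < n, w m = blockWord p (fun b => w (p - 1 + b * p)) m := by
  intro m
  induction m using Nat.strong_induction_on with
  | _ m ih =>
    intro hm
    set v : ℕ → Fin 2 := fun b => w (p - 1 + b * p)
    have hcount := count_congr_of_lt (m := m) fun i hi => ih i hi (hi.trans hm)
    have H := hw m hm
    rw [hcount, hcount] at H
    rcases lt_or_exists_block hp m with h | ⟨b, s, hs, rfl⟩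
    · rw [blockWord_of_lt v h]
      rw [count_blockWord_of_le v 0 h.le] at H
      refine (Fin.two_eq_zero_or_one (w m)).resolve_right fun h1 => ?_
      have := Nat.le_of_dvd (by simp) (H.2 h1)
      simp only [if_true] at this
      omega
    · rw [blockWord_block v b hs]
      rcases Nat.eq_zero_or_pos s with rfl | hs0
      · rfl
      rw [count_blockWord_block v 1 b hs.le, count_blockWord_block v 0 b hs.le] at H
      rcases Fin.two_eq_zero_or_one (v b) with hb | hb
      · rw [hb]
        refine (Fin.two_eq_zero_or_one _).resolve_right fun h1 => ?_
        have h2 := H.2 h1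
        simp only [hb, if_true] at h2
        have e : p - 1 + Nat.count (fun i => v i = 0) b * p + s + 1 =
            s + (1 + Nat.count (fun i => v i = 0) b) * p := by
          rw [Nat.add_mul]
          omega
        rw [e, Nat.dvd_add_left (Nat.dvd_mul_left _ _)] at h2
        exact absurd (Nat.le_of_dvd hs0 h2) (by omega)
      · rw [hb]
        refine (Fin.two_eq_zero_or_one _).resolve_left fun h1 => ?_
        have h2 := H.1 h1
        simp only [hb, if_true, one_ne_zero, if_false, Nat.zero_add] at h2
        rw [Nat.dvd_add_right (Nat.dvd_mul_left _ _)] at h2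
        exact absurd (Nat.le_of_dvd hs0 h2) (by omega)

/-- The column word of the first letters of the blocks of `t`. -/
def TwoColTab.blockLetters {n : ℕ} (t : TwoColTab n) (p b : ℕ) : Fin 2 :=
  extendWord t.col (p - 1 + b * p)

theorem TwoColTab.blockLetters_eq {n : ℕ} (t : TwoColTab n) {p b : ℕ} (h : p - 1 + b * p < n) :
    t.blockLetters p b = t.col ⟨p - 1 + b * p, h⟩ := dif_pos h

theorem TwoColTab.extendWord_eq_blockWord {p n : ℕ} (hp : 0 < p) {t : TwoColTab n}
    (ht : inOneColClass p n t.col) {m : ℕ} (hm : m < n) :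
    extendWord t.col m = blockWord p (t.blockLetters p) m :=
  eq_blockWord hp ((inOneColClass_iff_count fun i => (extendWord_val t.col i).symm).1 ht) m hm

theorem TwoColTab.col_eq_blockWord {p n : ℕ} (hp : 0 < p) {t : TwoColTab n}
    (ht : inOneColClass p n t.col) (j : Fin n) :
    t.col j = blockWord p (t.blockLetters p) j := by
  rw [← extendWord_eq_blockWord hp ht j.isLt, extendWord_val]

theorem TwoColTab.col_eq_blockLetters {p n : ℕ} (hp : 0 < p) {t : TwoColTab n}
    (ht : inOneColClass p n t.col) {b : ℕ} {j : Fin n}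
    (h : p - 1 + b * p ≤ j.val) (h' : j.val < p - 1 + b * p + p) :
    t.col j = t.blockLetters p b := by
  obtain ⟨s, hs⟩ := Nat.exists_eq_add_of_le h
  rw [col_eq_blockWord hp ht, hs, blockWord_block _ _ (by omega)]

theorem TwoColTab.ext_blockLetters {p n : ℕ} (hp : 0 < p) {t t' : TwoColTab n}
    (ht : inOneColClass p n t.col) (ht' : inOneColClass p n t'.col)
    (h : ∀ b, p - 1 + b * p < n → t.blockLetters p b = t'.blockLetters p b) : t = t' := by
  refine TwoColTab.ext' (funext fun j => ?_)
  rcases lt_or_exists_block hp j with hj | ⟨b, s, hs, hj⟩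
  · rw [col_eq_blockWord hp ht, col_eq_blockWord hp ht', blockWord_of_lt _ hj,
      blockWord_of_lt _ hj]
  · have := j.isLt
    rw [col_eq_blockLetters hp ht (b := b) (by omega) (by omega),
      col_eq_blockLetters hp ht' (b := b) (by omega) (by omega), h b (by omega)]

/-- The tableau formed by the first letters of the first `N` blocks. -/
def TwoColTab.blockTab {p n : ℕ} (hp : 0 < p) (N : ℕ) (hN : p - 1 + N * p ≤ n) (t : TwoColTab n)
    (ht : inOneColClass p n t.col) : TwoColTab N where
  col i := t.blockLetters p i
  ballot := by
    refine (ballot_iff_count fun _ => rfl).2 fun b hb => ?_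
    refine ballot_of_blockWord_ballot hp ?_
    have hle : p - 1 + b * p ≤ n := by
      have := Nat.mul_le_mul_right p hb
      omega
    have hcount := count_congr_of_lt (m := p - 1 + b * p) fun i hi =>
      extendWord_eq_blockWord hp ht (hi.trans_le hle)
    rw [← hcount, ← hcount]
    exact (ballot_iff_count fun i => (extendWord_val t.col i).symm).1 t.ballot _ hle

theorem TwoColTab.exists_blockLetters_eq {p n N : ℕ} (hp : 0 < p) (hN : n < p - 1 + N * p + p)
    (s : TwoColTab N) (e : Fin 2) :
    ∃ t : TwoColTab n, inOneColClass p n t.col ∧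
      (∀ i : Fin N, p - 1 + i.val * p < n → t.blockLetters p i = s.col i) ∧
      (p - 1 + N * p < n → t.blockLetters p N = e) := by
  set v : ℕ → Fin 2 := fun b => if h : b < N then s.col ⟨b, h⟩ else e with hv
  have hsv : ∀ i : Fin N, s.col i = v i := fun i => by simp [hv]
  have hbal := (ballot_iff_count hsv).1 s.ballot
  refine ⟨⟨fun i => blockWord p v i, ?_⟩, ?_, fun i hi => ?_, fun h => ?_⟩
  · exact (ballot_iff_count fun _ => rfl).2 fun m hm =>
      blockWord_ballot hp hbal (hm.trans_lt hN)
  · exact (inOneColClass_iff_count fun _ => rfl).2 fun j _ => blockWord_dvd_count hp v j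
  · rw [blockLetters_eq _ hi, hsv]
    exact blockWord_block v i hp
  · rw [blockLetters_eq _ h]
    exact (blockWord_block v N hp).trans (by simp [hv])

/-- Let `p > 2` be a prime with `p ≤ n`, `n = (p−1) + n1`,
`n1 = p·n2 + r`, `0 ≤ r < p`.  Every tableau `t` in the `p`-class of the
one-column standard tableau `t_n` has `1, …, p−1` in its first column, each of the
consecutive blocks `B_1, …, B_{n2}` of size `p` (and the final block of size `r`
when `r > 0`) lying in a single column of `t`; moreover the block-reading maps
`f_1 : [t_n] → Std(Par^{≤2}_{n2})` (when `r = 0`) and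
`f_2 : [t_n] → Std(Par^{≤2}_{n2}) × {1,2}` (when `r > 0`) are bijections. -/
theorem class_block_structure (p n n1 n2 r : ℕ) (hp : p.Prime) (hp2 : 2 < p) (hpn : p ≤ n)
    (hn : n = (p - 1) + n1) (hn1 : n1 = p * n2 + r) (hr : r < p) :
    (∀ t : TwoColTab n, inOneColClass p n t.col →
        (∀ j : Fin n, j.val < p - 1 → t.col j = 0) ∧
        (∀ b : ℕ, b < n2 → ∀ j j' : Fin n,
            p - 1 + b * p ≤ j.val → j.val < p - 1 + b * p + p →
            p - 1 + b * p ≤ j'.val → j'.val < p - 1 + b * p + p →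
            t.col j = t.col j') ∧
        (0 < r → ∀ j j' : Fin n,
            p - 1 + n2 * p ≤ j.val → p - 1 + n2 * p ≤ j'.val → t.col j = t.col j')) ∧
    (r = 0 →
      ∃ F : {t : TwoColTab n // inOneColClass p n t.col} → TwoColTab n2,
        Function.Bijective F ∧
        ∀ (t : {t : TwoColTab n // inOneColClass p n t.col}) (i : Fin n2),
          (F t).col i = t.val.col ⟨p - 1 + i.val * p, blockLt hp.pos hn hn1 i.isLt⟩) ∧
    (∀ hr0 : 0 < r,
      ∃ F : {t : TwoColTab n // inOneColClass p n t.col} → TwoColTab n2 × Fin 2,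
        Function.Bijective F ∧
        (∀ (t : {t : TwoColTab n // inOneColClass p n t.col}) (i : Fin n2),
          (F t).1.col i = t.val.col ⟨p - 1 + i.val * p, blockLt hp.pos hn hn1 i.isLt⟩) ∧
        (∀ t : {t : TwoColTab n // inOneColClass p n t.col},
          (F t).2 = t.val.col ⟨p - 1 + n2 * p, lastBlockLt hn hn1 hr0⟩)) := by
  have hp0 := hp.pos
  have hcomm := Nat.mul_comm p n2
  have hN : p - 1 + n2 * p ≤ n := by omega
  have hN' : n < p - 1 + n2 * p + p := by omega
  have hlt : ∀ b, p - 1 + b * p < n → b < n2 ∨ b = n2 ∧ 0 < r := by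
    intro b hb
    rcases lt_trichotomy b n2 with h | rfl | h
    · exact Or.inl h
    · exact Or.inr ⟨rfl, by omega⟩
    · have := Nat.mul_le_mul_right p (Nat.succ_le_of_lt h)
      rw [Nat.succ_mul] at this
      omega
  refine ⟨fun t ht => ⟨fun j hj => ?_, fun b _ j j' h1 h2 h3 h4 => ?_, fun _ j j' h1 h2 => ?_⟩,
    fun hr0 => ?_, fun hr0 => ?_⟩
  · rw [TwoColTab.col_eq_blockWord hp0 ht, blockWord_of_lt _ hj]
  · rw [TwoColTab.col_eq_blockLetters hp0 ht h1 h2, TwoColTab.col_eq_blockLetters hp0 ht h3 h4]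
  · rw [TwoColTab.col_eq_blockLetters hp0 ht h1 (j.isLt.trans hN'),
      TwoColTab.col_eq_blockLetters hp0 ht h2 (j'.isLt.trans hN')]
  · refine ⟨fun t => t.val.blockTab hp0 n2 hN t.property, ⟨fun t t' h => ?_, fun s => ?_⟩,
      fun t i => TwoColTab.blockLetters_eq _ _⟩
    · refine Subtype.ext (TwoColTab.ext_blockLetters hp0 t.property t'.property fun b hb => ?_)
      have hb' : b < n2 := by
        have := hlt b hb
        omega
      exact congrFun (congrArg TwoColTab.col h) ⟨b, hb'⟩
    · obtain ⟨t, ht, h, -⟩ := TwoColTab.exists_blockLetters_eq hp0 hN' s 0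
      exact ⟨⟨t, ht⟩, TwoColTab.ext' (funext fun i => h i (blockLt hp0 hn hn1 i.isLt))⟩
  · refine ⟨fun t => (t.val.blockTab hp0 n2 hN t.property, t.val.blockLetters p n2),
      ⟨fun t t' h => ?_, fun s => ?_⟩, fun t i => TwoColTab.blockLetters_eq _ _,
      fun t => TwoColTab.blockLetters_eq _ _⟩
    · refine Subtype.ext (TwoColTab.ext_blockLetters hp0 t.property t'.property fun b hb => ?_)
      rcases hlt b hb with hb' | ⟨rfl, -⟩
      · exact congrFun (congrArg (fun x => TwoColTab.col x.1) h) ⟨b, hb'⟩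
      · exact congrArg Prod.snd h
    · obtain ⟨t, ht, h, h'⟩ := TwoColTab.exists_blockLetters_eq hp0 hN' s.1 s.2
      exact ⟨⟨t, ht⟩, Prod.ext
        (TwoColTab.ext' (funext fun i => h i (blockLt hp0 hn hn1 i.isLt)))
        (h' (lastBlockLt hn hn1 hr0))⟩
end

section
/- Let p > 2 be a prime with p ≤ n, and write n + 1 = a_k p^k + a_{k−1} p^{k−1} + ⋯ + a_1 p + a_0 with 0 ≤ a_i < p and a_k ≠ 0. Then for every m ∈ I_n, the tableau t_m is a well-defined two-column standard tableau of size n, and it lies in the p-class of the one-column tableau: c_{t_m}(i) ≡ 1 − i (mod p) for all i = 1, …, n. -/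
/-- `upSum p a k i = Σ_{l=i}^{k} a_l p^l`, the starting position of the segment of the
digit `i − 1` in the word of length `n+1` obtained by reading the signed base-`p`
digits of `n+1` from the top digit `k` downwards. -/
def upSum (p : ℕ) (a : ℕ → ℕ) (k i : ℕ) : ℕ := ∑ l ∈ Finset.Ico i (k + 1), a l * p ^ l

/-- The sign attached to the digit `i`: the digits `0, …, k−1` carry the chosen signs
`ε` (`true` = `+`), and the top digit `k` is always positive. -/
def sgn (k : ℕ) (ε : Fin k → Bool) (i : ℕ) : Bool := if h : i < k then ε ⟨i, h⟩ else true

/-- The index of the digit governing position `q` of the word of length `n+1`: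
the smallest `i` with `Σ_{l>i} a_l p^l ≤ q`. -/
def digitAt (p : ℕ) (a : ℕ → ℕ) (k q : ℕ) : ℕ :=
  Nat.find (⟨k, by simp [upSum]⟩ : ∃ i, upSum p a k (i + 1) ≤ q)

/-- The column word of the tableau `t_m` associated to the sign choice `ε` (the element
`m = (a_k p^k ± a_{k−1} p^{k−1} ± ⋯ ± a_0) − 1` of `I_n`): the full word of length `n+1`
consists, for each digit `i = k, k−1, …, 0`, of a segment of length `a_i p^i` of
first-column letters (if the sign of `a_i` is `+`) or second-column letters (if `−`);
the word of `t_m` is obtained by deleting the first letter.  The entry `j+1` of `t_m`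
lies in the first column iff the sign of the digit governing position `j+1` is `+`. -/
def tmCol (p n k : ℕ) (a : ℕ → ℕ) (ε : Fin k → Bool) : Fin n → Fin 2 :=
  fun j => if sgn k ε (digitAt p a k (j.val + 1)) then 0 else 1

theorem upSum_antitone (p : ℕ) (a : ℕ → ℕ) (k : ℕ) : Antitone (upSum p a k) := by
  intro i j hij
  exact Finset.sum_le_sum_of_subset (Finset.Ico_subset_Ico_left hij)

theorem upSum_eq_add {p : ℕ} {a : ℕ → ℕ} {k i : ℕ} (hi : i ≤ k) :
    upSum p a k i = upSum p a k (i + 1) + a i * p ^ i := by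
  unfold upSum
  rw [Finset.sum_eq_sum_Ico_succ_bot (by omega), add_comm]

theorem upSum_succ_digitAt_le (p : ℕ) (a : ℕ → ℕ) (k q : ℕ) :
    upSum p a k (digitAt p a k q + 1) ≤ q :=
  Nat.find_spec (⟨k, by simp [upSum]⟩ : ∃ i, upSum p a k (i + 1) ≤ q)

theorem digitAt_le (p : ℕ) (a : ℕ → ℕ) (k q : ℕ) : digitAt p a k q ≤ k :=
  Nat.find_min' _ (by simp [upSum])

theorem digitAt_eq {p : ℕ} {a : ℕ → ℕ} {k i q : ℕ} (h₁ : upSum p a k (i + 1) ≤ q)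
    (h₂ : q < upSum p a k i) : digitAt p a k q = i := by
  refine (Nat.find_eq_iff _).2 ⟨h₁, fun m hm h => ?_⟩
  have := upSum_antitone p a k (show m + 1 ≤ i from hm)
  omega

theorem lt_upSum_digitAt {p : ℕ} {a : ℕ → ℕ} {k q : ℕ} (hq : q < upSum p a k 0) :
    q < upSum p a k (digitAt p a k q) := by
  rcases h : digitAt p a k q with _ | i
  · exact hq
  · have : ¬ upSum p a k (i + 1) ≤ q :=
      Nat.find_min (⟨k, by simp [upSum]⟩ : ∃ i, upSum p a k (i + 1) ≤ q)
        (show i < digitAt p a k q by omega)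
    omega

/-- Letters of a fixed sign are counted within a single segment. -/
theorem count_sgn_segment {p : ℕ} {a : ℕ → ℕ} {k : ℕ} (ε : Fin k → Bool) (c : Bool) {i r : ℕ}
    (hr : upSum p a k (i + 1) + r ≤ upSum p a k i) :
    Nat.count (fun q => sgn k ε (digitAt p a k q) = c) (upSum p a k (i + 1) + r) =
      Nat.count (fun q => sgn k ε (digitAt p a k q) = c) (upSum p a k (i + 1)) +
        if sgn k ε i = c then r else 0 := by
  induction r with
  | zero => simp
  | succ r ih =>
    rw [← add_assoc, Nat.count_succ, ih (by omega),
      digitAt_eq (i := i) (by omega) (by omega)]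
    split_ifs <;> omega

theorem pow_dvd_count_sgn {p : ℕ} {a : ℕ → ℕ} {k : ℕ} (ε : Fin k → Bool) (c : Bool) {i : ℕ}
    (hi : i ≤ k + 1) :
    p ^ i ∣ Nat.count (fun q => sgn k ε (digitAt p a k q) = c) (upSum p a k i) := by
  induction hi using Nat.decreasingInduction with
  | self => simp [upSum]
  | of_succ i hi ih =>
    have h := upSum_eq_add (p := p) (a := a) (Nat.lt_succ_iff.1 hi)
    rw [h, count_sgn_segment ε c h.ge]
    refine dvd_add ((pow_dvd_pow p i.le_succ).trans ih) ?_
    split_ifs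
    · exact dvd_mul_left _ _
    · exact dvd_zero _

/-- At a letter of sign `!c`, the number of letters of sign `c` so far is divisible by `p`. -/
theorem dvd_count_sgn {p : ℕ} {a : ℕ → ℕ} {k q : ℕ} (ε : Fin k → Bool) {c : Bool}
    (hq : q < upSum p a k 0) (hc : sgn k ε (digitAt p a k q) ≠ c) :
    p ∣ Nat.count (fun q => sgn k ε (digitAt p a k q) = c) (q + 1) := by
  have h₁ := upSum_succ_digitAt_le p a k q
  have h₂ := lt_upSum_digitAt hq
  have h₃ := digitAt_le p a k q
  obtain ⟨r, hr⟩ := Nat.exists_eq_add_of_le (show _ ≤ q + 1 from h₁.trans q.le_succ)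
  rw [hr, count_sgn_segment ε c (by omega), if_neg hc, add_zero]
  exact (dvd_pow_self p (Nat.succ_ne_zero _)).trans (pow_dvd_count_sgn ε c (by omega))

theorem count_sgn_add_count_sgn (p : ℕ) (a : ℕ → ℕ) (k : ℕ) (ε : Fin k → Bool) (m : ℕ) :
    Nat.count (fun q => sgn k ε (digitAt p a k q) = true) m +
      Nat.count (fun q => sgn k ε (digitAt p a k q) = false) m = m := by
  induction m with
  | zero => simp
  | succ m ih =>
    rw [Nat.count_succ, Nat.count_succ]
    cases sgn k ε (digitAt p a k m) <;> simp <;> omega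

theorem sum_digits_lt_pow {p k : ℕ} {a : ℕ → ℕ} (ha : ∀ i < k, a i < p) :
    ∑ i ∈ Finset.range k, a i * p ^ i < p ^ k := by
  induction k with
  | zero => simp
  | succ k ih =>
    rw [Finset.sum_range_succ, pow_succ]
    have h₁ := ih fun i hi => ha i (by omega)
    have h₂ := Nat.mul_le_mul_right (p ^ k) (ha k (by omega))
    rw [Nat.succ_mul] at h₂
    rw [mul_comm (p ^ k)]
    omega

theorem sgn_digitAt_of_lt {p : ℕ} {a : ℕ → ℕ} {k q : ℕ} (ε : Fin k → Bool)
    (hq : q < upSum p a k k) : sgn k ε (digitAt p a k q) = true := by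
  rw [digitAt_eq (i := k) (by simp [upSum]) hq]
  simp [sgn]

/-- Second-column letters are strictly fewer than first-column letters in every nonempty
prefix of the full word. -/
theorem count_sgn_false_lt {p : ℕ} {a : ℕ → ℕ} {k m : ℕ} (ε : Fin k → Bool)
    (ha : ∀ i < k, a i < p) (hak : a k ≠ 0) (hm : 0 < m) (hmn : m ≤ upSum p a k 0) :
    Nat.count (fun q => sgn k ε (digitAt p a k q) = false) m <
      Nat.count (fun q => sgn k ε (digitAt p a k q) = true) m := by
  have htop : ∀ r ≤ upSum p a k k,
      Nat.count (fun q => sgn k ε (digitAt p a k q) = true) r = r := fun r hr =>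
    Nat.count_iff_forall.2 fun q hq => sgn_digitAt_of_lt ε (by omega)
  have hadd := count_sgn_add_count_sgn p a k ε m
  rcases le_total m (upSum p a k k) with h | h
  · have := htop m h
    omega
  · have h₁ := Nat.count_monotone (fun q => sgn k ε (digitAt p a k q) = true) h
    rw [htop _ le_rfl] at h₁
    have h₂ : upSum p a k k = a k * p ^ k := by simp [upSum]
    have h₃ : upSum p a k 0 = ∑ i ∈ Finset.range k, a i * p ^ i + a k * p ^ k := by
      simp [upSum, Finset.sum_range_succ]
    have h₄ := sum_digits_lt_pow ha
    have h₅ := Nat.le_mul_of_pos_left (p ^ k) (Nat.pos_of_ne_zero hak)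
    omega

theorem card_filter_fin_le {n : ℕ} (P : ℕ → Prop) [DecidablePred P] (j : Fin n) :
    (Finset.univ.filter fun i : Fin n => i ≤ j ∧ P (i.val + 1)).card + (if P 0 then 1 else 0) =
      Nat.count P (j.val + 2) := by
  rw [Nat.count_succ', Nat.count_eq_card_filter_range]
  congr 1
  refine Finset.card_bij (fun i _ => i.val) ?_ (fun _ _ _ _ h => Fin.ext h) ?_
  · intro i hi
    simp only [Finset.mem_filter, Finset.mem_univ, true_and, Finset.mem_range,
      Fin.le_def] at hi ⊢
    exact ⟨by omega, hi.2⟩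
  · intro b hb
    simp only [Finset.mem_filter, Finset.mem_range] at hb
    refine ⟨⟨b, by omega⟩, Finset.mem_filter.2 ⟨Finset.mem_univ _, ?_, hb.2⟩, rfl⟩
    exact Fin.le_def.2 (Nat.lt_succ_iff.1 hb.1)

theorem tmCol_eq_zero_iff {p n k : ℕ} {a : ℕ → ℕ} {ε : Fin k → Bool} {j : Fin n} :
    tmCol p n k a ε j = 0 ↔ sgn k ε (digitAt p a k (j.val + 1)) = true := by
  unfold tmCol
  split_ifs with h <;> simp [h]

theorem tmCol_eq_one_iff {p n k : ℕ} {a : ℕ → ℕ} {ε : Fin k → Bool} {j : Fin n} :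
    tmCol p n k a ε j = 1 ↔ sgn k ε (digitAt p a k (j.val + 1)) = false := by
  unfold tmCol
  split_ifs with h <;> simp [h]

/-- Let `p > 2` be a prime with `p ≤ n` and let
`n + 1 = a_k p^k + ⋯ + a_1 p + a_0` be the base-`p` expansion (`0 ≤ a_i < p`,
`a_k ≠ 0`).  For every `m ∈ I_n`, i.e. for every choice of signs
`ε : Fin k → Bool`, the word `t_m` is a well-defined two-column standard tableau
of size `n` (the ballot condition holds), and it lies in the `p`-class of the
one-column tableau: `c_{t_m}(i) ≡ 1 − i (mod p)` for all `i = 1, …, n`. -/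
theorem tm_standard_and_in_class (p n k : ℕ) (a : ℕ → ℕ)
    (hp : p.Prime) (hp2 : 2 < p) (hpn : p ≤ n)
    (ha : ∀ i, i ≤ k → a i < p) (hak : a k ≠ 0)
    (hsum : n + 1 = ∑ i ∈ Finset.range (k + 1), a i * p ^ i) :
    ∀ ε : Fin k → Bool,
      ∃ t : TwoColTab n, t.col = tmCol p n k a ε ∧
        ∀ j : Fin n, ((tabContent t j : ℤ) : ZMod p) = ((1 - ((j.val : ℤ) + 1) : ℤ) : ZMod p) := by
  intro ε
  have hn : upSum p a k 0 = n + 1 := by rw [hsum, upSum, Finset.range_eq_Ico]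
  have hpos : 0 < upSum p a k k := by
    simpa [upSum] using ⟨Nat.pos_of_ne_zero hak, pow_pos hp.pos k⟩
  have h_first := sgn_digitAt_of_lt ε hpos
  have hcard₀ : ∀ j : Fin n,
      (Finset.univ.filter fun i : Fin n => i ≤ j ∧ tmCol p n k a ε i = 0).card + 1 =
        Nat.count (fun q => sgn k ε (digitAt p a k q) = true) (j.val + 2) := fun j => by
    simp only [← card_filter_fin_le, tmCol_eq_zero_iff, if_pos h_first]
  have hcard₁ : ∀ j : Fin n,
      (Finset.univ.filter fun i : Fin n => i ≤ j ∧ tmCol p n k a ε i = 1).card =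
        Nat.count (fun q => sgn k ε (digitAt p a k q) = false) (j.val + 2) := fun j => by
    simp [← card_filter_fin_le, tmCol_eq_one_iff, h_first]
  refine ⟨⟨tmCol p n k a ε, fun j => ?_⟩, rfl, fun j => ?_⟩
  · have h := count_sgn_false_lt (m := j.val + 2) ε (fun i hi => ha i hi.le) hak (by omega)
      (by omega)
    have := hcard₀ j
    have := hcard₁ j
    omega
  · have hj : j.val + 1 < upSum p a k 0 := by omega
    have hadd := count_sgn_add_count_sgn p a k ε (j.val + 2)
    have h₀ := hcard₀ j
    have h₁ := hcard₁ j
    rw [ZMod.intCast_eq_intCast_iff_dvd_sub]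
    simp only [tabContent, colContent]
    split_ifs with hc
    · rw [tmCol_eq_zero_iff] at hc
      obtain ⟨d, hd⟩ := dvd_count_sgn (c := false) ε hj (by simp [hc])
      refine ⟨-d, ?_⟩
      zify at *
      linarith
    · rw [tmCol_eq_zero_iff] at hc
      obtain ⟨d, hd⟩ := dvd_count_sgn (c := true) ε hj hc
      refine ⟨-d, ?_⟩
      zify at *
      linarith
end

section
/- Let p > 2 be a prime with p ≤ n, write n + 1 = a_k p^k + ⋯ + a_1 p + a_0 in base p with a_k ≠ 0 and k ≥ 1, and write n = (p−1) + n_1, n_1 = p·n_2 + r (so r = a_0 and n_2 + 1 = a_k p^{k−1} + ⋯ + a_1). Fix signs ε_1, …, ε_{k−1} ∈ {±1}, let m = (a_k p^{k−1} + ε_{k−1} a_{k−1} p^{k−2} + ⋯ + ε_1 a_1) − 1 ∈ I_{n_2}, and set M = a_k p^k + ε_{k−1} a_{k−1} p^{k−1} + ⋯ + ε_1 a_1 p. Then the set {t ∈ [t_n] : f(t) = t_m} equals {t_{(M + a_0) − 1}, t_{(M − a_0) − 1}} if a_0 ≠ 0, and equals {t_{M − 1}} if a_0 = 0. -/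
/-- Extend the sign sequence `(ε_1, …, ε_{k−1})` for the digits `1, …, k−1` by the
sign `s` for the digit `0`. -/
def extSign (k : ℕ) (s : Bool) (ε : Fin (k - 1) → Bool) : Fin k → Bool :=
  fun i => if h : i.val = 0 then s else ε ⟨i.val - 1, by have := i.isLt; omega⟩

/-- The column word of size `n` with the deleted first letter (a first-column letter) restored,
padded by first-column letters beyond position `n`. -/
def fullWord {n : ℕ} (c : Fin n → Fin 2) : ℕ → Fin 2
  | 0 => 0
  | j + 1 => if h : j < n then c ⟨j, h⟩ else 0

/-- The letter at position `q` of the signed digit word. -/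
def digitLetter (p k : ℕ) (a : ℕ → ℕ) (ε : Fin k → Bool) (q : ℕ) : Fin 2 :=
  if sgn k ε (digitAt p a k q) then 0 else 1

theorem fullWord_succ {n : ℕ} (c : Fin n → Fin 2) {j : ℕ} (h : j < n) :
    fullWord c (j + 1) = c ⟨j, h⟩ := by
  simp [fullWord, h]

theorem eq_iff_fullWord_eq {n : ℕ} (c d : Fin n → Fin 2) :
    c = d ↔ ∀ q < n + 1, fullWord c q = fullWord d q := by
  constructor
  · rintro rfl q _
    rfl
  · intro h
    funext j
    have := h (j.val + 1) (by omega)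
    rwa [fullWord_succ c j.isLt, fullWord_succ d j.isLt] at this

/-- If membership in `P` is constant on the blocks of size `p` below `q`, the number of
elements of `P` below `q` is determined modulo `p` by the block of `q`. -/
theorem count_mod_of_blockConst {p : ℕ} (hp : 0 < p) (P : ℕ → Prop) [DecidablePred P] (q : ℕ)
    (h : ∀ i < q, (P i ↔ P (p * (i / p)))) :
    Nat.count P q % p = if P (p * (q / p)) then q % p else 0 := by
  induction q with
  | zero => simp
  | succ q ih =>
    have ih := ih fun i hi => h i (by omega)
    have hq := h q (by omega)
    have hlt := Nat.mod_lt q hp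
    have e : Nat.count P (q + 1) % p = if P (p * (q / p)) then (q + 1) % p else 0 := by
      rw [Nat.count_succ]
      by_cases hP : P (p * (q / p))
      · rw [if_pos hP] at ih
        rw [if_pos (hq.2 hP), if_pos hP, Nat.add_mod, ih, ← Nat.add_mod]
      · rw [if_neg hP] at ih
        rw [if_neg (fun h' => hP (hq.1 h')), if_neg hP, Nat.add_zero, ih]
    rw [e]
    by_cases hd : p ∣ q + 1
    · simp [Nat.mod_eq_zero_of_dvd hd]
    · rw [Nat.succ_div_of_not_dvd hd]

theorem dvd_count_iff_blockConst {α : Type*} [DecidableEq α] {p : ℕ} (hp : 0 < p)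
    (v : ℕ → α) (N : ℕ) :
    (∀ q < N, p ∣ Nat.count (fun i => v i ≠ v q) q) ↔ ∀ q < N, v q = v (p * (q / p)) := by
  constructor
  · intro h q
    induction q using Nat.strong_induction_on with
    | _ q ih =>
      intro hq
      have key := count_mod_of_blockConst hp (fun i => v i ≠ v q) q
        (fun i hi => by rw [ih i hi (by omega)])
      rw [Nat.mod_eq_zero_of_dvd (h q hq)] at key
      by_contra hne
      rw [if_pos (Ne.symm hne)] at key
      exact hne (by rw [Nat.mul_div_cancel' (Nat.dvd_of_mod_eq_zero key.symm)])
  · intro h q hq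
    have key := count_mod_of_blockConst hp (fun i => v i ≠ v q) q
      (fun i hi => by rw [h i (by omega)])
    rw [if_neg (by simp [← h q hq])] at key
    exact Nat.dvd_of_mod_eq_zero key

theorem card_filter_le_eq_count {n : ℕ} (c : Fin n → Fin 2) (x : Fin 2) (j : Fin n) :
    (Finset.univ.filter fun i : Fin n => i ≤ j ∧ c i = x).card =
      Nat.count (fun q => fullWord c (q + 1) = x) (j.val + 1) := by
  rw [Nat.count_eq_card_filter_range]
  refine Finset.card_bij (fun i _ => i.val) ?_ ?_ ?_
  · intro i hi
    simp only [Finset.mem_filter, Finset.mem_univ, true_and, Finset.mem_range] at hi ⊢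
    rw [fullWord_succ c i.isLt]
    exact ⟨Nat.lt_succ_of_le hi.1, hi.2⟩
  · intro i _ i' _ h
    exact Fin.ext h
  · intro b hb
    simp only [Finset.mem_filter, Finset.mem_range] at hb
    have hbn : b < n := by omega
    rw [fullWord_succ c hbn] at hb
    refine ⟨⟨b, hbn⟩, ?_, rfl⟩
    simp only [Finset.mem_filter, Finset.mem_univ, true_and]
    exact ⟨Fin.le_def.2 (by simpa using Nat.le_of_lt_succ hb.1), hb.2⟩

theorem count_add_count_ne {α : Type*} [DecidableEq α] (v : ℕ → α) (x : α) (q : ℕ) :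
    Nat.count (fun i => v i = x) q + Nat.count (fun i => v i ≠ x) q = q := by
  induction q with
  | zero => simp
  | succ q ih =>
    rw [Nat.count_succ, Nat.count_succ]
    by_cases h : v q = x
    · rw [if_pos h, if_neg (not_not_intro h)]
      omega
    · rw [if_neg h, if_pos h]
      omega

theorem colContent_add_val {n : ℕ} (c : Fin n → Fin 2) (j : Fin n) :
    colContent c j + j.val =
      Nat.count (fun i => fullWord c i ≠ fullWord c (j.val + 1)) (j.val + 1) := by
  have hj := fullWord_succ c j.isLt
  have h1 := count_add_count_ne (fun i => fullWord c (i + 1)) (c j) (j.val + 1)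
  have h2 : Nat.count (fun i => fullWord c (i + 1) ≠ c j) (j.val + 1) =
      Nat.count (fun i => fullWord c (i + 1) ≠ c j) j.val := by
    rw [Nat.count_succ, if_neg (by simp [hj]), Nat.add_zero]
  have h3 := Nat.count_succ' (fun i => fullWord c i ≠ c j) j.val
  have h4 : fullWord c 0 = 0 := rfl
  rw [hj]
  change _ = ((Nat.count (fun i => fullWord c i ≠ c j) (j.val + 1) : ℕ) : ℤ)
  unfold colContent
  rw [card_filter_le_eq_count, card_filter_le_eq_count]
  by_cases hc : c j = 0
  · rw [hc] at h1 h2 h3 ⊢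
    rw [h4] at h3
    simp only [ne_eq, not_true_eq_false, if_false, if_true] at h1 h2 h3 ⊢
    omega
  · have hc1 : c j = 1 := by omega
    rw [hc1] at h1 h2 h3 ⊢
    rw [h4] at h3
    simp only [ne_eq, zero_ne_one, one_ne_zero, not_false_eq_true, if_false, if_true]
      at h1 h2 h3 ⊢
    omega

theorem inOneColClass_iff_blockConst {p n : ℕ} (hp : 0 < p) (c : Fin n → Fin 2) :
    inOneColClass p n c ↔
      ∀ q < n + 1, fullWord c q = fullWord c (p * (q / p)) := by
  rw [← dvd_count_iff_blockConst hp]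
  have key (j : Fin n) : ((colContent c j : ℤ) : ZMod p) = ((-(j.val : ℤ) : ℤ) : ZMod p) ↔
      p ∣ Nat.count (fun i => fullWord c i ≠ fullWord c (j.val + 1)) (j.val + 1) := by
    rw [← Int.natCast_dvd_natCast, ← colContent_add_val, ← ZMod.intCast_zmod_eq_zero_iff_dvd]
    push_cast
    rw [eq_neg_iff_add_eq_zero]
  constructor
  · intro h q hq
    cases q with
    | zero => simp
    | succ j => exact (key ⟨j, by omega⟩).1 (h ⟨j, by omega⟩)
  · intro h j
    exact (key j).2 (h _ (by omega))

theorem upSum_succ (p : ℕ) (a : ℕ → ℕ) {k : ℕ} (hk : 1 ≤ k) (i : ℕ) :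
    upSum p a k (i + 1) = p * upSum p (fun l => a (l + 1)) (k - 1) i := by
  unfold upSum
  rw [show k - 1 + 1 = k by omega, Finset.mul_sum, ← Finset.sum_Ico_add' _ i k 1]
  exact Finset.sum_congr rfl fun l _ => by ring

theorem digitAt_blockStart {p : ℕ} (hp : 0 < p) (a : ℕ → ℕ) {k : ℕ} (hk : 1 ≤ k) (q : ℕ) :
    digitAt p a k q = digitAt p a k (p * (q / p)) := by
  unfold digitAt
  refine Nat.find_congr' fun {i} => ?_
  rw [upSum_succ p a hk, mul_le_mul_iff_right₀ hp, Nat.le_div_iff_mul_le hp, mul_comm]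

theorem digitAt_eq_zero {p : ℕ} {a : ℕ → ℕ} {k q : ℕ} (h : upSum p a k 1 ≤ q) :
    digitAt p a k q = 0 :=
  (Nat.find_eq_zero _).2 h

theorem digitAt_mul {p : ℕ} (hp : 0 < p) (a : ℕ → ℕ) {k : ℕ} (hk : 1 ≤ k) {b : ℕ}
    (h : b < upSum p (fun l => a (l + 1)) (k - 1) 0) :
    digitAt p a k (p * b) = digitAt p (fun l => a (l + 1)) (k - 1) b + 1 := by
  have hstep (i : ℕ) : upSum p a k (i + 1) ≤ p * b ↔
      upSum p (fun l => a (l + 1)) (k - 1) i ≤ b := by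
    rw [upSum_succ p a hk, mul_le_mul_iff_right₀ hp]
  refine (Nat.find_eq_iff _).2 ⟨?_, ?_⟩
  · rw [hstep]
    exact Nat.find_spec (p := fun i => upSum p (fun l => a (l + 1)) (k - 1) (i + 1) ≤ b) _
  · intro i hi
    rw [hstep]
    cases i with
    | zero => omega
    | succ i =>
      exact Nat.find_min (p := fun i => upSum p (fun l => a (l + 1)) (k - 1) (i + 1) ≤ b) _
        (Nat.lt_of_succ_lt_succ hi)

theorem digitAt_zero {p : ℕ} (hp : 0 < p) {a : ℕ → ℕ} {k : ℕ} (hak : a k ≠ 0) :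
    digitAt p a k 0 = k := by
  refine (Nat.find_eq_iff _).2 ⟨by simp [upSum], fun i hi h => ?_⟩
  have hle : a k * p ^ k ≤ upSum p a k (i + 1) :=
    Finset.single_le_sum (f := fun l => a l * p ^ l) (fun _ _ => Nat.zero_le _)
      (Finset.mem_Ico.2 ⟨hi, Nat.lt_succ_self k⟩)
  have := Nat.mul_pos (Nat.pos_of_ne_zero hak) (Nat.pow_pos (n := k) hp)
  omega

theorem digitLetter_zero {p : ℕ} (hp : 0 < p) {a : ℕ → ℕ} {k : ℕ} (hak : a k ≠ 0)
    (ε : Fin k → Bool) : digitLetter p k a ε 0 = 0 := by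
  simp [digitLetter, digitAt_zero hp hak, sgn]

theorem fullWord_tmCol {p : ℕ} (hp : 0 < p) {a : ℕ → ℕ} {k : ℕ} (hak : a k ≠ 0)
    (ε : Fin k → Bool) {n q : ℕ} (hq : q < n + 1) :
    fullWord (tmCol p n k a ε) q = digitLetter p k a ε q := by
  cases q with
  | zero => exact (digitLetter_zero hp hak ε).symm
  | succ j =>
    rw [fullWord_succ _ (by omega)]
    rfl

theorem sgn_extSign_succ {k : ℕ} (hk : 1 ≤ k) (s : Bool) (ε : Fin (k - 1) → Bool) (i : ℕ) :
    sgn k (extSign k s ε) (i + 1) = sgn (k - 1) ε i := by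
  unfold sgn extSign
  by_cases h : i + 1 < k
  · simp [h, show i < k - 1 by omega]
  · simp [h, show ¬ i < k - 1 by omega]

theorem sgn_extSign_zero {k : ℕ} (hk : 1 ≤ k) (s : Bool) (ε : Fin (k - 1) → Bool) :
    sgn k (extSign k s ε) 0 = s := by
  simp [sgn, extSign, show 0 < k by omega]

theorem digitLetter_blockStart {p : ℕ} (hp : 0 < p) (a : ℕ → ℕ) {k : ℕ} (hk : 1 ≤ k)
    (ε : Fin k → Bool) (q : ℕ) :
    digitLetter p k a ε q = digitLetter p k a ε (p * (q / p)) := by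
  rw [digitLetter, digitAt_blockStart hp a hk, digitLetter]

theorem digitLetter_extSign_mul {p : ℕ} (hp : 0 < p) (a : ℕ → ℕ) {k : ℕ} (hk : 1 ≤ k)
    (s : Bool) (ε : Fin (k - 1) → Bool) {b : ℕ}
    (h : b < upSum p (fun l => a (l + 1)) (k - 1) 0) :
    digitLetter p k a (extSign k s ε) (p * b) =
      digitLetter p (k - 1) (fun l => a (l + 1)) ε b := by
  rw [digitLetter, digitAt_mul hp a hk h, sgn_extSign_succ hk, digitLetter]

theorem digitLetter_extSign_upSum {p : ℕ} (a : ℕ → ℕ) {k : ℕ} (hk : 1 ≤ k)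
    (s : Bool) (ε : Fin (k - 1) → Bool) :
    digitLetter p k a (extSign k s ε) (p * upSum p (fun l => a (l + 1)) (k - 1) 0) =
      if s then 0 else 1 := by
  rw [digitLetter, digitAt_eq_zero (upSum_succ p a hk 0).le, sgn_extSign_zero hk]

/-- Let `p > 2` be a prime with `p ≤ n`, let
`n + 1 = a_k p^k + ⋯ + a_0` in base `p` with `a_k ≠ 0`, `k ≥ 1`, and write
`n = (p−1) + (p·n_2 + a_0)`.  Fix signs `ε_1, …, ε_{k−1}`, let
`m = (a_k p^{k−1} + ε_{k−1} a_{k−1} p^{k−2} + ⋯ + ε_1 a_1) − 1 ∈ I_{n_2}` and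
`M = a_k p^k + ε_{k−1} a_{k−1} p^{k−1} + ⋯ + ε_1 a_1 p`.  Then
`{t ∈ [t_n] : f(t) = t_m}` equals `{t_{(M+a_0)−1}, t_{(M−a_0)−1}}` if `a_0 ≠ 0`,
and `{t_{M−1}}` if `a_0 = 0`.  (Here `f(t)` is pointwise the block-reading of
`t.col`, `t_m` at size `n_2` is built from the digits `a_1, …, a_k` of `n_2 + 1`
and the signs `ε`, and `t_{(M±a_0)−1}` is built from the digits of `n+1` and the
signs `ε` extended by `±` on the digit `0`.) -/
theorem fibre_of_blockReading_eq_tm (p n k n2 : ℕ) (a : ℕ → ℕ)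
    (hp : p.Prime) (hp2 : 2 < p) (hpn : p ≤ n) (hk : 1 ≤ k)
    (ha : ∀ i, i ≤ k → a i < p) (hak : a k ≠ 0)
    (hsum : n + 1 = ∑ i ∈ Finset.range (k + 1), a i * p ^ i)
    (hn : n = (p - 1) + (p * n2 + a 0))
    (ε : Fin (k - 1) → Bool) :
    ∀ t : TwoColTab n,
      (inOneColClass p n t.col ∧
        ∀ i : Fin n2,
          t.col ⟨p - 1 + i.val * p, blockLt hp.pos hn rfl i.isLt⟩ =
            tmCol p n2 (k - 1) (fun l => a (l + 1)) ε i) ↔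
      (t.col = tmCol p n k a (extSign k true ε) ∨
        (a 0 ≠ 0 ∧ t.col = tmCol p n k a (extSign k false ε))) := by
  have hp0 := hp.pos
  intro t
  have hU : upSum p (fun l => a (l + 1)) (k - 1) 0 = n2 + 1 := by
    have h0 : n + 1 = upSum p a k 1 + a 0 := by
      rw [hsum, Finset.sum_range_succ', upSum, Finset.range_eq_Ico,
        Finset.sum_Ico_add' (fun l => a l * p ^ l) 0 k 1]
      simp
    rw [upSum_succ p a hk 0] at h0
    refine Nat.eq_of_mul_eq_mul_left hp0 ?_
    rw [Nat.mul_add, Nat.mul_one]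
    omega
  have hNn : n + 1 = p * (n2 + 1) + a 0 := by
    rw [Nat.mul_add, Nat.mul_one]
    omega
  have ha0 := ha 0 (Nat.zero_le k)
  have hak' : (fun l => a (l + 1)) (k - 1) ≠ 0 := by
    simpa [Nat.sub_add_cancel hk] using hak
  have hW0 : fullWord t.col 0 = 0 := rfl
  have hcol (s : Bool) : t.col = tmCol p n k a (extSign k s ε) ↔
      ∀ q < n + 1, fullWord t.col q = digitLetter p k a (extSign k s ε) q := by
    rw [eq_iff_fullWord_eq]
    refine forall₂_congr fun q hq => ?_
    rw [fullWord_tmCol hp0 hak _ hq]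
  have hblock : (∀ i : Fin n2,
        t.col ⟨p - 1 + i.val * p, blockLt hp.pos hn rfl i.isLt⟩ =
          tmCol p n2 (k - 1) (fun l => a (l + 1)) ε i) ↔
      ∀ b < n2 + 1, fullWord t.col (p * b) =
        digitLetter p (k - 1) (fun l => a (l + 1)) ε b := by
    have e (i : ℕ) (hi : i < n2) : fullWord t.col (p * (i + 1)) =
        t.col ⟨p - 1 + i * p, blockLt hp.pos hn rfl hi⟩ := by
      rw [← fullWord_succ t.col (blockLt hp.pos hn rfl hi)]
      congr 1
      rw [Nat.mul_add, Nat.mul_one, Nat.mul_comm p i]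
      omega
    constructor
    · intro h b hb
      cases b with
      | zero => rw [Nat.mul_zero, hW0, digitLetter_zero (a := fun l => a (l + 1)) hp0 hak']
      | succ i =>
        rw [e i (by omega), h ⟨i, by omega⟩]
        rfl
    · intro h i
      rw [← e i i.isLt, h _ (by omega)]
      rfl
  rw [inOneColClass_iff_blockConst hp0, hblock, hcol, hcol]
  constructor
  · rintro ⟨hconst, hread⟩
    have main (s : Bool)
        (hs : a 0 ≠ 0 → fullWord t.col (p * (n2 + 1)) = if s then 0 else 1) :
        ∀ q < n + 1, fullWord t.col q = digitLetter p k a (extSign k s ε) q := by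
      intro q hq
      rw [hconst q hq, digitLetter_blockStart hp0 a hk]
      rcases Nat.lt_or_ge (q / p) (n2 + 1) with hb | hb
      · rw [hread _ hb, digitLetter_extSign_mul hp0 a hk s ε (by omega)]
      · have hle := Nat.mul_le_mul_left p hb
        have hqp := Nat.mul_div_le q p
        have hb' : q / p = n2 + 1 := by
          refine le_antisymm (Nat.le_of_lt_succ ((Nat.div_lt_iff_lt_mul hp0).2 ?_)) hb
          rw [Nat.mul_comm, Nat.mul_succ]
          omega
        rw [hb', hs (by omega), ← hU, digitLetter_extSign_upSum a hk]
    by_cases h : fullWord t.col (p * (n2 + 1)) = 0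
    · exact Or.inl (main true fun _ => by simpa using h)
    · by_cases hz : a 0 = 0
      · exact Or.inl (main true fun h' => absurd hz h')
      · refine Or.inr ⟨hz, main false fun _ => ?_⟩
        simp only [Bool.false_eq_true, if_false]
        omega
  · have main (s : Bool)
        (h : ∀ q < n + 1, fullWord t.col q = digitLetter p k a (extSign k s ε) q) :
        (∀ q < n + 1, fullWord t.col q = fullWord t.col (p * (q / p))) ∧
          ∀ b < n2 + 1, fullWord t.col (p * b) =
            digitLetter p (k - 1) (fun l => a (l + 1)) ε b := by
      constructor
      · intro q hq
        have hqp := Nat.mul_div_le q p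
        rw [h q hq, h _ (by omega), ← digitLetter_blockStart hp0 a hk]
      · intro b hb
        have hlt := Nat.mul_lt_mul_of_pos_left hb hp0
        rw [h _ (by omega), digitLetter_extSign_mul hp0 a hk s ε (by omega)]
    rintro (h | ⟨_, h⟩)
    · exact main true h
    · exact main false h
end

section
/- Let λ and μ be partitions of n whose Young diagrams have at most two columns, and let s be a standard λ-tableau and t a standard μ-tableau. If c_s(i) = c_t(i) for all i = 1, 2, …, n, then s = t (in particular λ = μ). -/
/-- If a column word `c` and a two-column standard tableau agree before `j` and have the same
content at `j`, then `c j = 0` forces the tableau to have `j` in the first column. -/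
theorem TwoColTab.col_eq_zero_of_colContent_eq {n : ℕ} {c : Fin n → Fin 2} (t : TwoColTab n)
    {j : Fin n} (hlt : ∀ i < j, c i = t.col i) (h : colContent c j = tabContent t j)
    (hc : c j = 0) : t.col j = 0 := by
  by_contra ht
  have hsub : (Finset.univ.filter fun i : Fin n => i ≤ j ∧ t.col i = 0) ⊆
      Finset.univ.filter fun i : Fin n => i ≤ j ∧ c i = 0 := by
    intro i hi
    simp only [Finset.mem_filter, Finset.mem_univ, true_and] at hi ⊢
    obtain ⟨hij, hi⟩ := hi
    refine ⟨hij, ?_⟩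
    rcases hij.lt_or_eq with hij | rfl
    · rw [hlt i hij, hi]
    · exact hc
  have hcard := Finset.card_le_card hsub
  have hballot := t.ballot j
  rw [tabContent, colContent, colContent, if_pos hc, if_neg ht] at h
  omega

/-- **separation.** If two two-column standard tableaux of size `n`
have the same content function, they are equal (in particular their shapes agree). -/
theorem twoColTab_content_injective (n : ℕ) (s t : TwoColTab n)
    (h : ∀ j : Fin n, tabContent s j = tabContent t j) : s = t := by
  apply TwoColTab.ext'
  funext j
  induction j using WellFoundedLT.induction with
  | ind j ih =>
    have hst := t.col_eq_zero_of_colContent_eq ih (h j)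
    have hts := s.col_eq_zero_of_colContent_eq (fun i hi => (ih i hi).symm) (h j).symm
    omega
end

section
/- For every n ≥ 0, the Temperley–Lieb algebra TL_n^ℚ over the rational numbers (with loop parameter 2) is a semisimple ring. -/
/-- Relations defining the Temperley–Lieb algebra with loop parameter `2`,
on generators `u_1, …, u_{n-1}` (indexed by `Fin (n-1)`). -/
inductive TLRel (R : Type) [CommRing R] (n : ℕ) :
    FreeAlgebra R (Fin (n - 1)) → FreeAlgebra R (Fin (n - 1)) → Prop
  | sq (i : Fin (n - 1)) :
      TLRel R n (FreeAlgebra.ι R i * FreeAlgebra.ι R i) (2 * FreeAlgebra.ι R i)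
  | braid (i j : Fin (n - 1)) (h : Nat.dist i.val j.val = 1) :
      TLRel R n (FreeAlgebra.ι R i * FreeAlgebra.ι R j * FreeAlgebra.ι R i) (FreeAlgebra.ι R i)
  | comm (i j : Fin (n - 1)) (h : 1 < Nat.dist i.val j.val) :
      TLRel R n (FreeAlgebra.ι R i * FreeAlgebra.ι R j) (FreeAlgebra.ι R j * FreeAlgebra.ι R i)

/-- The Temperley–Lieb algebra `TL_n` over `R`, with loop parameter `2`. -/
abbrev TL (R : Type) [CommRing R] (n : ℕ) : Type := RingQuot (TLRel R n)

/-- The generator `u_{i+1}` of the Temperley–Lieb algebra. -/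
noncomputable def TLu (R : Type) [CommRing R] (n : ℕ) (i : Fin (n - 1)) : TL R n :=
  RingQuot.mkAlgHom R (TLRel R n) (FreeAlgebra.ι R i)

/-- The left ideal `Σ_b A e b` is also a right ideal. -/
theorem mul_mem_span_range {A : Type*} [Ring A] {e x : A}
    (hx : x ∈ Ideal.span (Set.range (e * ·))) (c : A) :
    x * c ∈ Ideal.span (Set.range (e * ·)) := by
  induction hx using Submodule.span_induction with
  | mem x hx =>
    obtain ⟨b, rfl⟩ := hx
    exact Ideal.subset_span ⟨b * c, by simp only [mul_assoc]⟩
  | zero => simp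
  | add x y _ _ hx hy => rw [add_mul]; exact add_mem hx hy
  | smul a x _ hx => rw [smul_eq_mul, mul_assoc]; exact Ideal.mul_mem_left _ a hx

/-- If the left multiples of `p` are its scalar multiples, then the left ideal generated by `p` is
zero or simple. -/
theorem isSemisimpleModule_span_singleton_of_smul {K B : Type*} [Field K] [Ring B] [Algebra K B]
    {p : B} (hp : ∀ b, ∃ r : K, b * p = r • p) : IsSemisimpleModule B (Ideal.span {p}) := by
  refine (isSemisimpleModule_iff _ _).2 ⟨fun N => ?_⟩
  by_cases hN : N = ⊥
  · exact ⟨⊤, hN ▸ isCompl_bot_top⟩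
  · suffices N = ⊤ from ⟨⊥, this ▸ isCompl_top_bot⟩
    obtain ⟨⟨x, hx⟩, hxN, hx0⟩ := (Submodule.ne_bot_iff N).1 hN
    obtain ⟨b, rfl⟩ := Ideal.mem_span_singleton'.1 hx
    obtain ⟨r, hr⟩ := hp b
    have hr0 : r ≠ 0 := by
      rintro rfl
      exact hx0 (Subtype.ext (by simpa using hr))
    refine eq_top_iff.2 fun y _ => ?_
    obtain ⟨y, hy⟩ := y
    obtain ⟨c, rfl⟩ := Ideal.mem_span_singleton'.1 hy
    convert N.smul_mem (c * algebraMap K B r⁻¹) hxN using 1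
    apply Subtype.ext
    simp [hr, mul_assoc, ← Algebra.smul_def, smul_smul, hr0]

section Corner

variable {R B : Type*} [Ring R] [IsSemisimpleRing R] [Ring B] (φ : R →+* B) {e p : B}

/-- The left ideal generated by `e` is semisimple if the corner `e B e` lies in `R e`, for a
semisimple ring `R` commuting with `e`, and no nonzero element of `B e` is annihilated by `e B`. -/
theorem isSemisimpleModule_span_singleton_of_corner
    (hcomm : ∀ r, φ r * e = e * φ r) (hcorner : ∀ b, ∃ r, e * b * e = φ r * e)
    (hann : ∀ x ∈ Ideal.span {e}, (∀ b, e * b * x = 0) → x = 0) :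
    IsSemisimpleModule B (Ideal.span {e}) := by
  refine (isSemisimpleModule_iff _ _).2 ⟨fun N => ?_⟩
  have hmem (r : R) : φ r * e ∈ Ideal.span {e} := Ideal.mem_span_singleton'.2 ⟨_, rfl⟩
  let ψ (r : R) : Ideal.span {e} := ⟨φ r * e, hmem r⟩
  let L : Ideal R :=
    { carrier := {r | ψ r ∈ N}
      add_mem' := fun {a b} ha hb => by
        have : ψ (a + b) = ψ a + ψ b := Subtype.ext (by simp [ψ, add_mul])
        simpa only [Set.mem_ofPred_eq, this] using N.add_mem ha hb
      zero_mem' := by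
        have : ψ 0 = 0 := Subtype.ext (by simp [ψ])
        simp only [Set.mem_ofPred_eq, this, N.zero_mem]
      smul_mem' := fun c a ha => by
        have : ψ (c • a) = φ c • ψ a := Subtype.ext (by simp [ψ, mul_assoc])
        simpa only [Set.mem_ofPred_eq, this] using N.smul_mem (φ c) ha }
  obtain ⟨T, hT⟩ := exists_isCompl L
  have key : ∀ x ∈ Submodule.span B (ψ '' T), ∀ b, ∃ t ∈ T, e * b * (x : B) = φ t * e := by
    intro x hx
    induction hx using Submodule.span_induction with
    | mem x hx =>
      obtain ⟨t, ht, rfl⟩ := hx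
      intro b
      obtain ⟨r, hr⟩ := hcorner b
      refine ⟨r * t, T.mul_mem_left r ht, ?_⟩
      rw [show ((ψ t : Ideal.span {e}) : B) = φ t * e from rfl, hcomm, ← mul_assoc, hr, mul_assoc,
        ← hcomm, ← mul_assoc, map_mul]
    | zero => exact fun b => ⟨0, T.zero_mem, by simp⟩
    | add x y _ _ hx hy =>
      intro b
      obtain ⟨s, hs, hsx⟩ := hx b
      obtain ⟨t, ht, hty⟩ := hy b
      exact ⟨s + t, T.add_mem hs ht, by simp [mul_add, add_mul, hsx, hty]⟩
    | smul a x _ hx =>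
      intro b
      obtain ⟨t, ht, htx⟩ := hx (b * a)
      exact ⟨t, ht, by simpa [mul_assoc] using htx⟩
  refine ⟨Submodule.span B (ψ '' T), ?_, ?_⟩
  · refine Submodule.disjoint_def.2 fun x hxN hxT => Subtype.ext (hann x x.2 fun b => ?_)
    obtain ⟨t, ht, htx⟩ := key x hxT b
    have htL : t ∈ L := by
      have : ψ t = (e * b) • x := Subtype.ext htx.symm
      change ψ t ∈ N
      exact this ▸ N.smul_mem _ hxN
    rw [htx, Submodule.disjoint_def.1 hT.disjoint t htL ht, map_zero, zero_mul]
  · refine codisjoint_iff.2 (eq_top_iff.2 fun x _ => ?_)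
    obtain ⟨a, ha, t, ht, hat⟩ :=
      Submodule.mem_sup.1 (hT.sup_eq_top ▸ Submodule.mem_top : (1 : R) ∈ L ⊔ T)
    obtain ⟨x, hx⟩ := x
    obtain ⟨b, rfl⟩ := Ideal.mem_span_singleton'.1 hx
    have : (⟨b * e, hx⟩ : Ideal.span {e}) = b • (ψ a + ψ t) := by
      apply Subtype.ext
      simp only [ψ, SetLike.val_smul, Submodule.coe_add, smul_eq_mul]
      rw [← add_mul, ← map_add, hat, map_one, one_mul]
    rw [this]
    exact Submodule.smul_mem _ _ (Submodule.add_mem_sup ha (Submodule.subset_span ⟨t, ht, rfl⟩))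

/-- A ring `B` is semisimple if, modulo a semisimple left ideal `B p` with `p B e = 0`, it is
generated by `e` as a two-sided ideal, and the corner `e B e` lies in `R e` for a semisimple ring
`R` commuting with `e`. -/
theorem isSemisimpleRing_of_corner
    (hcomm : ∀ r, φ r * e = e * φ r) (hcorner : ∀ b, ∃ r, e * b * e = φ r * e)
    (hp : 1 - p ∈ Ideal.span (Set.range (e * ·))) (hpe : ∀ b, p * b * e = 0)
    [IsSemisimpleModule B (Ideal.span {p})] : IsSemisimpleRing B := by
  have hann : ∀ x ∈ Ideal.span {e}, (∀ b, e * b * x = 0) → x = 0 := by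
    intro x hx h
    obtain ⟨c, rfl⟩ := Ideal.mem_span_singleton'.1 hx
    have hz : ∀ y ∈ Ideal.span (Set.range (e * ·)), y * (c * e) = 0 := by
      intro y hy
      induction hy using Submodule.span_induction with
      | mem y hy =>
        obtain ⟨b, rfl⟩ := hy
        exact h b
      | zero => simp
      | add y z _ _ hy hz => rw [add_mul, hy, hz, add_zero]
      | smul a y _ hy => rw [smul_eq_mul, mul_assoc, hy, mul_zero]
    have := hz _ hp
    rwa [sub_mul, one_mul, ← mul_assoc p, hpe, sub_zero] at this
  have := isSemisimpleModule_span_singleton_of_corner φ hcomm hcorner hann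
  let f (i : Option B) : Ideal B := i.elim (Ideal.span {p}) fun b =>
    (LinearMap.toSpanSingleton B B b ∘ₗ (Ideal.span {e}).subtype).range
  refine isSemisimpleModule_of_isSemisimpleModule_submodule' (p := f) ?_ ?_
  · rintro (_ | b)
    · assumption
    · exact IsSemisimpleModule.range _
  · refine (Ideal.eq_top_iff_one _).2 ?_
    rw [← sub_add_cancel 1 p]
    refine add_mem (Ideal.span_le.2 ?_ hp) ?_
    · rintro _ ⟨b, rfl⟩
      exact Submodule.mem_iSup_of_mem (p := f) (some b)
        ⟨⟨e, Ideal.mem_span_singleton_self e⟩, rfl⟩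
    · exact Submodule.mem_iSup_of_mem (p := f) none (Ideal.mem_span_singleton_self p)

end Corner

/-- The Temperley–Lieb relations (loop parameter `2`) for the first `N` terms of a sequence. -/
structure IsTLSeq {A : Type} [Ring A] (u : ℕ → A) (N : ℕ) : Prop where
  sq : ∀ i, i < N → u i * u i = 2 * u i
  braid_up : ∀ i, i + 1 < N → u i * u (i + 1) * u i = u i
  braid_down : ∀ i, i + 1 < N → u (i + 1) * u i * u (i + 1) = u (i + 1)
  comm : ∀ i j, i + 1 < j → j < N → u i * u j = u j * u i

namespace IsTLSeq

variable {A : Type} [Ring A] {u : ℕ → A} {N : ℕ}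

theorem mem_span_range_last (hu : IsTLSeq u N) {k i : ℕ} (hk : k < N) (hi : i ≤ k) :
    u i ∈ Ideal.span (Set.range (u k * ·)) := by
  induction hi using Nat.decreasingInduction with
  | self => exact Ideal.subset_span ⟨1, by simp⟩
  | of_succ i hi ih =>
    rw [← hu.braid_up i (by omega), mul_assoc]
    exact Ideal.mul_mem_left _ _ (mul_mem_span_range ih _)

variable [Algebra ℚ A]

/-- The subalgebra generated by the first `k` terms of `u`. -/
def initAlg (u : ℕ → A) (k : ℕ) : Subalgebra ℚ A :=
  Algebra.adjoin ℚ (u '' Set.Iio k)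

theorem mem_initAlg {i k : ℕ} (h : i < k) : u i ∈ initAlg u k :=
  Algebra.subset_adjoin ⟨i, h, rfl⟩

theorem initAlg_mono {j k : ℕ} (h : j ≤ k) : initAlg u j ≤ initAlg u k :=
  Algebra.adjoin_mono (Set.image_mono (Set.Iio_subset_Iio h))

theorem initAlg_zero : initAlg u 0 = ⊥ := by
  simp [initAlg]

theorem commute_of_mem_initAlg (hu : IsTLSeq u N) {k : ℕ} (hk : k < N) {x : A}
    (hx : x ∈ initAlg u (k - 1)) : x * u k = u k * x := by
  induction hx using Algebra.adjoin_induction with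
  | mem x hx =>
    obtain ⟨i, hi, rfl⟩ := hx
    exact hu.comm i k (by simp only [Set.mem_Iio] at hi; omega) hk
  | algebraMap r => exact Algebra.commutes r _
  | add x y _ _ hx hy => rw [add_mul, mul_add, hx, hy]
  | mul x y _ _ hx hy => rw [mul_assoc, hy, ← mul_assoc, hx, mul_assoc]

/-- The spanning set `S ∪ S u_k S` of the algebra generated by `u_0, …, u_k`, where `S` is the
algebra generated by `u_0, …, u_{k-1}`. -/
def sandwich (u : ℕ → A) (k : ℕ) : Set A :=
  {x | x ∈ initAlg u k ∨ ∃ a ∈ initAlg u k, ∃ b ∈ initAlg u k, x = a * u k * b}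

theorem initAlg_succ_le_span {k : ℕ}
    (h : ∀ x ∈ initAlg u k, ∃ y ∈ initAlg u (k - 1), u k * x * u k = y * u k) {x : A}
    (hx : x ∈ initAlg u (k + 1)) : x ∈ Submodule.span ℚ (sandwich u k) := by
  induction hx using Algebra.adjoin_induction with
  | mem x hx =>
    obtain ⟨i, hi, rfl⟩ := hx
    apply Submodule.subset_span
    rcases Nat.lt_succ_iff_lt_or_eq.1 hi with hi | rfl
    · exact Or.inl (mem_initAlg hi)
    · exact Or.inr ⟨1, one_mem _, 1, one_mem _, by simp⟩
  | algebraMap r => exact Submodule.subset_span (Or.inl (Subalgebra.algebraMap_mem _ r))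
  | add x y _ _ hx hy => exact add_mem hx hy
  | mul x y _ _ hx hy =>
    have hxy := Submodule.mul_mem_mul hx hy
    rw [Submodule.span_mul_span] at hxy
    refine Submodule.span_mono ?_ hxy
    rintro _ ⟨x, hx, y, hy, rfl⟩
    rcases hx with hx | ⟨a, ha, b, hb, rfl⟩ <;> rcases hy with hy | ⟨c, hc, d, hd, rfl⟩
    · exact Or.inl (mul_mem hx hy)
    · exact Or.inr ⟨x * c, mul_mem hx hc, d, hd, by simp only [mul_assoc]⟩
    · exact Or.inr ⟨a, ha, b * y, mul_mem hb hy, by simp only [mul_assoc]⟩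
    · obtain ⟨z, hz, hzu⟩ := h (b * c) (mul_mem hb hc)
      refine Or.inr ⟨a * z, mul_mem ha (initAlg_mono (Nat.sub_le k 1) hz), d, hd, ?_⟩
      calc a * u k * b * (c * u k * d) = a * (u k * (b * c) * u k) * d := by
            simp only [mul_assoc]
        _ = a * z * u k * d := by rw [hzu]; simp only [mul_assoc]

theorem exists_compress_of_span {S : Subalgebra ℚ A} {v : A} {G : Set A}
    (hG : ∀ x ∈ G, ∃ y ∈ S, v * x * v = y * v) {x : A} (hx : x ∈ Submodule.span ℚ G) :
    ∃ y ∈ S, v * x * v = y * v := by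
  induction hx using Submodule.span_induction with
  | mem x hx => exact hG x hx
  | zero => exact ⟨0, zero_mem _, by simp⟩
  | add x y _ _ hx hy =>
    obtain ⟨a, ha, hax⟩ := hx
    obtain ⟨b, hb, hby⟩ := hy
    exact ⟨a + b, add_mem ha hb, by rw [mul_add, add_mul, add_mul, hax, hby]⟩
  | smul r x _ hx =>
    obtain ⟨a, ha, hax⟩ := hx
    exact ⟨r • a, Subalgebra.smul_mem _ ha r, by simp [hax]⟩

theorem exists_compress_initAlg (hu : IsTLSeq u N) {k : ℕ} (hk : k < N) :
    ∀ x ∈ initAlg u k, ∃ y ∈ initAlg u (k - 1), u k * x * u k = y * u k := by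
  induction k with
  | zero =>
    intro x hx
    rw [initAlg_zero, Algebra.mem_bot] at hx
    obtain ⟨r, rfl⟩ := hx
    refine ⟨algebraMap ℚ A r * 2, mul_mem (Subalgebra.algebraMap_mem _ r) (ofNat_mem _ 2), ?_⟩
    rw [← Algebra.commutes r (u 0), mul_assoc, hu.sq 0 hk, mul_assoc]
  | succ k ih =>
    intro x hx
    refine exists_compress_of_span ?_ (initAlg_succ_le_span (ih (by omega)) hx)
    have hc : ∀ a ∈ initAlg u k, a * u (k + 1) = u (k + 1) * a :=
      fun a ha => hu.commute_of_mem_initAlg hk ha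
    rintro x (hx | ⟨a, ha, b, hb, rfl⟩)
    · refine ⟨x * 2, mul_mem hx (ofNat_mem _ 2), ?_⟩
      rw [← hc x hx, mul_assoc, hu.sq _ hk, mul_assoc]
    · refine ⟨a * b, mul_mem ha hb, ?_⟩
      calc u (k + 1) * (a * u k * b) * u (k + 1)
          = (u (k + 1) * a) * u k * (b * u (k + 1)) := by simp only [mul_assoc]
        _ = a * (u (k + 1) * u k * u (k + 1)) * b := by
            rw [← hc a ha, hc b hb]; simp only [mul_assoc]
        _ = a * b * u (k + 1) := by rw [hu.braid_down k hk, mul_assoc, ← hc b hb, mul_assoc]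

theorem exists_compress_initAlg_succ (hu : IsTLSeq u N) {k : ℕ} (hk : k < N) {x : A}
    (hx : x ∈ initAlg u (k + 1)) : ∃ y ∈ initAlg u (k - 1), u k * x * u k = y * u k := by
  have h := hu.exists_compress_initAlg hk
  refine exists_compress_of_span ?_ (initAlg_succ_le_span h hx)
  rintro x (hx | ⟨a, ha, b, hb, rfl⟩)
  · exact h x hx
  · obtain ⟨y, hy, hya⟩ := h a ha
    obtain ⟨z, hz, hzb⟩ := h b hb
    refine ⟨y * z, mul_mem hy hz, ?_⟩
    calc u k * (a * u k * b) * u k = (u k * a * u k) * b * u k := by simp only [mul_assoc]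
      _ = y * (u k * b * u k) := by rw [hya]; simp only [mul_assoc]
      _ = y * z * u k := by rw [hzb, mul_assoc]

/-- The Jones–Wenzl elements, given by Wenzl's recursion. -/
noncomputable def jonesWenzl (u : ℕ → A) : ℕ → A
  | 0 => 1
  | k + 1 => jonesWenzl u k -
      ((k + 1 : ℚ) / (k + 2)) • (jonesWenzl u k * u k * jonesWenzl u k)

theorem jonesWenzl_mem (u : ℕ → A) (k : ℕ) : jonesWenzl u k ∈ initAlg u k := by
  induction k with
  | zero => exact one_mem _
  | succ k ih =>
    have h := initAlg_mono (Nat.le_succ k) ih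
    exact sub_mem h (Subalgebra.smul_mem _ (mul_mem (mul_mem h (mem_initAlg k.lt_succ_self)) h) _)

theorem jonesWenzl_spec (hu : IsTLSeq u N) {k : ℕ} (hk : k ≤ N) :
    jonesWenzl u k * jonesWenzl u k = jonesWenzl u k ∧
    (∀ i < k, u i * jonesWenzl u k = 0 ∧ jonesWenzl u k * u i = 0) ∧
    (jonesWenzl u (k - 1) * jonesWenzl u k = jonesWenzl u k ∧
      jonesWenzl u k * jonesWenzl u (k - 1) = jonesWenzl u k) ∧
    (k < N → u k * jonesWenzl u k * u k =
      ((k + 2 : ℚ) / (k + 1)) • (jonesWenzl u (k - 1) * u k)) := by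
  induction k with
  | zero => simp +contextual [jonesWenzl, hu.sq, two_mul, two_smul]
  | succ k ih =>
    obtain ⟨hidem, hkill, ⟨habs, habs'⟩, hcomp⟩ := ih (by omega)
    specialize hcomp (by omega)
    have hcomm := hu.commute_of_mem_initAlg (k := k) (by omega) (jonesWenzl_mem u (k - 1))
    set p := jonesWenzl u k with hp
    set q := jonesWenzl u (k - 1) with hq
    have hr : jonesWenzl u (k + 1) = p - ((k + 1 : ℚ) / (k + 2)) • (p * u k * p) := rfl
    have hcancel : ((k + 1 : ℚ) / (k + 2)) * ((k + 2 : ℚ) / (k + 1)) = 1 := by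
      have : (k : ℚ) + 1 ≠ 0 := by positivity
      have : (k : ℚ) + 2 ≠ 0 := by positivity
      field_simp
    have hpr : p * jonesWenzl u (k + 1) = jonesWenzl u (k + 1) := by
      rw [hr, mul_sub, hidem, mul_smul_comm, ← mul_assoc, ← mul_assoc, hidem]
    have hrp : jonesWenzl u (k + 1) * p = jonesWenzl u (k + 1) := by
      rw [hr, sub_mul, hidem, smul_mul_assoc, mul_assoc, hidem]
    have hur : u k * jonesWenzl u (k + 1) = 0 := by
      rw [hr, mul_sub, mul_smul_comm, ← mul_assoc, ← mul_assoc, hcomp, smul_mul_assoc, smul_smul,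
        hcancel, one_smul, hcomm, mul_assoc, habs, sub_self]
    have hru : jonesWenzl u (k + 1) * u k = 0 := by
      rw [hr, sub_mul, smul_mul_assoc, mul_assoc, mul_assoc, ← mul_assoc (u k), hcomp,
        mul_smul_comm, smul_smul, hcancel, one_smul, ← mul_assoc, habs', sub_self]
    refine ⟨?_, ?_, ⟨hpr, hrp⟩, ?_⟩
    · nth_rw 2 [hr]
      rw [mul_sub, hrp, mul_smul_comm, ← mul_assoc, ← mul_assoc, hrp, hru, zero_mul, smul_zero,
        sub_zero]
    · intro i hi
      rcases Nat.lt_succ_iff_lt_or_eq.1 hi with hi | rfl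
      · rw [← hpr, ← mul_assoc, (hkill i hi).1, zero_mul, hpr, ← hrp, mul_assoc, (hkill i hi).2,
          mul_zero]
        exact ⟨rfl, rfl⟩
      · exact ⟨hur, hru⟩
    · intro hk'
      have hc := hu.commute_of_mem_initAlg hk' (jonesWenzl_mem u k)
      rw [← hp] at hc
      have h1 : u (k + 1) * p * u (k + 1) = 2 • (p * u (k + 1)) := by
        rw [← hc, mul_assoc, hu.sq _ hk', two_mul, mul_add, two_smul]
      have h2 : u (k + 1) * (p * u k * p) * u (k + 1) = p * u (k + 1) := by
        calc u (k + 1) * (p * u k * p) * u (k + 1)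
            = (u (k + 1) * p) * u k * (p * u (k + 1)) := by simp only [mul_assoc]
          _ = (p * u (k + 1)) * u k * (u (k + 1) * p) := by rw [hc]
          _ = p * (u (k + 1) * u k * u (k + 1)) * p := by simp only [mul_assoc]
          _ = p * u (k + 1) := by
              rw [hu.braid_down k hk', mul_assoc, ← hc, ← mul_assoc, hidem]
      rw [hr, mul_sub, sub_mul, h1, mul_smul_comm, smul_mul_assoc, h2, Nat.add_sub_cancel, ← hp,
        ← Nat.cast_smul_eq_nsmul ℚ, ← sub_smul]
      congr 1
      have : (k : ℚ) + 2 ≠ 0 := by positivity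
      push_cast
      field_simp
      ring

theorem one_sub_jonesWenzl_mem (hu : IsTLSeq u N) {k j : ℕ} (hk : k < N) (hj : j ≤ k + 1) :
    1 - jonesWenzl u j ∈ Ideal.span (Set.range (u k * ·)) := by
  induction j with
  | zero => simp [jonesWenzl]
  | succ j ih =>
    rw [jonesWenzl, ← sub_add, ← smul_mul_assoc, ← smul_mul_assoc]
    exact add_mem (ih (by omega))
      (mul_mem_span_range (Ideal.mul_mem_left _ _ (hu.mem_span_range_last hk (by omega))) _)

theorem exists_mul_jonesWenzl (hu : IsTLSeq u N) {x : A} (hx : x ∈ initAlg u N) :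
    ∃ r : ℚ, x * jonesWenzl u N = r • jonesWenzl u N ∧
      jonesWenzl u N * x = r • jonesWenzl u N := by
  obtain ⟨-, hkill, -⟩ := hu.jonesWenzl_spec le_rfl
  induction hx using Algebra.adjoin_induction with
  | mem x hx =>
    obtain ⟨i, hi, rfl⟩ := hx
    exact ⟨0, by simpa using hkill i hi⟩
  | algebraMap r => exact ⟨r, by rw [← Algebra.commutes, Algebra.smul_def]; simp⟩
  | add x y _ _ hx hy =>
    obtain ⟨r, hr, hr'⟩ := hx
    obtain ⟨s, hs, hs'⟩ := hy
    exact ⟨r + s, by rw [add_mul, hr, hs, add_smul], by rw [mul_add, hr', hs', add_smul]⟩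
  | mul x y _ _ hx hy =>
    obtain ⟨r, hr, hr'⟩ := hx
    obtain ⟨s, hs, hs'⟩ := hy
    exact ⟨r * s, by rw [mul_assoc, hs, mul_smul_comm, hr, smul_smul, mul_comm],
      by rw [← mul_assoc, hr', smul_mul_assoc, hs', smul_smul]⟩

/-- The Temperley–Lieb relations are inherited by the subalgebra generated by fewer terms. -/
theorem exists_initAlg (hu : IsTLSeq u N) {k : ℕ} (hk : k ≤ N) :
    ∃ v : ℕ → initAlg u k, IsTLSeq v k ∧ initAlg v k = ⊤ := by
  let v (i : ℕ) : initAlg u k := if h : i < k then ⟨u i, mem_initAlg h⟩ else 0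
  have hv {i : ℕ} (h : i < k) : (v i : A) = u i := by simp [v, h]
  refine ⟨v, ⟨fun i hi => ?_, fun i hi => ?_, fun i hi => ?_, fun i j hij hj => ?_⟩, ?_⟩
  · apply Subtype.ext
    simpa [hv hi, two_mul] using hu.sq i (by omega)
  · apply Subtype.ext
    simpa [hv hi, hv (i.lt_succ_self.trans hi)] using hu.braid_up i (by omega)
  · apply Subtype.ext
    simpa [hv hi, hv (i.lt_succ_self.trans hi)] using hu.braid_down i (by omega)
  · apply Subtype.ext
    simpa [hv hj, hv (show i < k by omega)] using hu.comm i j hij (by omega)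
  · refine eq_top_iff.2 ((Algebra.adjoin_adjoin_coe_preimage (s := u '' Set.Iio k)).ge.trans
      (Algebra.adjoin_mono ?_))
    rintro x ⟨i, hi, hix⟩
    exact ⟨i, hi, Subtype.ext ((hv hi).trans hix)⟩

/-- A rational algebra generated by elements satisfying the Temperley–Lieb relations is
semisimple. -/
theorem isSemisimpleRing {A : Type} [Ring A] [Algebra ℚ A] {u : ℕ → A} {N : ℕ}
    (hu : IsTLSeq u N) (htop : initAlg u N = ⊤) : IsSemisimpleRing A := by
  induction N using Nat.strong_induction_on generalizing A with
  | _ N ih =>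
  have hmem (x : A) : x ∈ initAlg u N := htop ▸ Algebra.mem_top
  rcases N with _ | k
  · refine (algebraMap ℚ A).isSemisimpleRing_of_surjective fun x => ?_
    simpa [initAlg_zero, Algebra.mem_bot] using hmem x
  obtain ⟨v, hv, hvtop⟩ := hu.exists_initAlg (k := k - 1) (by omega)
  have := ih (k - 1) (by omega) hv hvtop
  have hk : k < k + 1 := k.lt_succ_self
  have hp := fun b => hu.exists_mul_jonesWenzl (hmem b)
  have : IsSemisimpleModule A (Ideal.span {jonesWenzl u (k + 1)}) :=
    isSemisimpleModule_span_singleton_of_smul (K := ℚ) fun b =>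
      (hp b).imp fun _ h => h.1
  refine isSemisimpleRing_of_corner (initAlg u (k - 1)).val.toRingHom (e := u k) ?_ ?_
    (hu.one_sub_jonesWenzl_mem hk le_rfl) ?_
  · exact fun x => hu.commute_of_mem_initAlg hk x.2
  · intro b
    obtain ⟨y, hy, hyb⟩ := hu.exists_compress_initAlg_succ hk (hmem b)
    exact ⟨⟨y, hy⟩, hyb⟩
  · intro b
    obtain ⟨r, -, hr⟩ := hp b
    have hkill := ((hu.jonesWenzl_spec le_rfl).2.1 k hk).2
    rw [hr, smul_mul_assoc, hkill, smul_zero]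

end IsTLSeq

/-- For every `n ≥ 0`, the Temperley–Lieb algebra `TL_n^ℚ` over the
rational numbers (with loop parameter `2`) is a semisimple ring. -/
theorem TL_rat_isSemisimpleRing (n : ℕ) : IsSemisimpleRing (TL ℚ n) := by
  let u (i : ℕ) : TL ℚ n := if h : i < n - 1 then TLu ℚ n ⟨i, h⟩ else 0
  have hu {i : ℕ} (h : i < n - 1) : u i = TLu ℚ n ⟨i, h⟩ := dif_pos h
  have hrel {x y : FreeAlgebra ℚ (Fin (n - 1))} (h : TLRel ℚ n x y) :=
    RingQuot.mkAlgHom_rel ℚ h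
  have hTL : IsTLSeq u (n - 1) := by
    refine ⟨fun i hi => ?_, fun i hi => ?_, fun i hi => ?_, fun i j hij hj => ?_⟩
    · rw [hu hi]
      simpa [TLu, two_mul] using hrel (TLRel.sq ⟨i, hi⟩)
    · rw [hu hi, hu (i.lt_succ_self.trans hi)]
      simpa [TLu] using hrel (TLRel.braid ⟨i, i.lt_succ_self.trans hi⟩ ⟨i + 1, hi⟩
        (by simp [Nat.dist]))
    · rw [hu hi, hu (i.lt_succ_self.trans hi)]
      simpa [TLu] using hrel (TLRel.braid ⟨i + 1, hi⟩ ⟨i, i.lt_succ_self.trans hi⟩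
        (by simp [Nat.dist]))
    · rw [hu hj, hu (show i < n - 1 by omega)]
      simpa [TLu] using hrel (TLRel.comm ⟨i, by omega⟩ ⟨j, hj⟩ (by simp only [Nat.dist]; omega))
  refine hTL.isSemisimpleRing ?_
  have hmap := (RingQuot.mkAlgHom ℚ (TLRel ℚ n)).map_adjoin (Set.range (FreeAlgebra.ι ℚ))
  rw [FreeAlgebra.adjoin_range_ι, Algebra.map_top,
    AlgHom.range_eq_top _ |>.2 (RingQuot.mkAlgHom_surjective ℚ _)] at hmap
  refine eq_top_iff.2 (hmap.le.trans (Algebra.adjoin_mono ?_))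
  rintro _ ⟨_, ⟨i, rfl⟩, rfl⟩
  exact ⟨i, i.2, hu i.2⟩
end

section
/- Define elements JW_n ∈ TL_n^ℚ recursively by JW_1 = 1 and, for n ≥ 2, JW_n = ι(JW_{n−1}) − ((n−1)/n)·ι(JW_{n−1}) u_{n−1} ι(JW_{n−1}), where ι : TL_{n−1}^ℚ → TL_n^ℚ is the algebra homomorphism with ι(u_i) = u_i for i = 1, …, n−2. Then for every n ≥ 1, JW_n is a nonzero idempotent satisfying u_i JW_n = JW_n u_i = 0 for all 1 ≤ i ≤ n−1, and JW_n is the unique nonzero idempotent of TL_n^ℚ with this property. -/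
theorem TLu_mul_self (R : Type) [CommRing R] (n : ℕ) (i : Fin (n - 1)) :
    TLu R n i * TLu R n i = 2 * TLu R n i := by
  have h := RingQuot.mkAlgHom_rel R (TLRel.sq (R := R) (n := n) i)
  simpa [TLu, map_mul, map_ofNat] using h

theorem TLu_braid (R : Type) [CommRing R] (n : ℕ) (i j : Fin (n - 1))
    (h : Nat.dist i.val j.val = 1) :
    TLu R n i * TLu R n j * TLu R n i = TLu R n i := by
  have h' := RingQuot.mkAlgHom_rel R (TLRel.braid (R := R) (n := n) i j h)
  simpa [TLu, map_mul] using h'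

theorem TLu_comm (R : Type) [CommRing R] (n : ℕ) (i j : Fin (n - 1))
    (h : 1 < Nat.dist i.val j.val) :
    TLu R n i * TLu R n j = TLu R n j * TLu R n i := by
  have h' := RingQuot.mkAlgHom_rel R (TLRel.comm (R := R) (n := n) i j h)
  simpa [TLu, map_mul] using h'

/-- The canonical (non-unital only in the trivial sense: it is unital) algebra inclusion
`TL_m → TL_n` for `m ≤ n`, sending `u_i` to `u_i`. -/
noncomputable def TLincl (R : Type) [CommRing R] {m n : ℕ} (h : m ≤ n) :
    TL R m →ₐ[R] TL R n :=
  RingQuot.liftAlgHom R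
    ⟨FreeAlgebra.lift R
        (fun i : Fin (m - 1) => TLu R n ⟨i.val, by have := i.isLt; omega⟩), by
      intro x y hxy
      induction hxy with
      | sq i =>
          simp only [map_mul, FreeAlgebra.lift_ι_apply, map_ofNat]
          exact TLu_mul_self R n _
      | braid i j hd =>
          simp only [map_mul, FreeAlgebra.lift_ι_apply]
          exact TLu_braid R n _ _ hd
      | comm i j hd =>
          simp only [map_mul, FreeAlgebra.lift_ι_apply]
          exact TLu_comm R n _ _ hd⟩

/-- The Jones–Wenzl elements, defined recursively by `JW_1 = 1` and
`JW_n = ι(JW_{n−1}) − ((n−1)/n)·ι(JW_{n−1}) u_{n−1} ι(JW_{n−1})`. -/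
noncomputable def JW : (n : ℕ) → TL ℚ n
  | 0 => 1
  | 1 => 1
  | n + 2 =>
      TLincl ℚ (Nat.le_succ (n + 1)) (JW (n + 1)) -
        (((n : ℚ) + 1) / ((n : ℚ) + 2)) •
          (TLincl ℚ (Nat.le_succ (n + 1)) (JW (n + 1)) *
            TLu ℚ (n + 2) ⟨n, by omega⟩ *
            TLincl ℚ (Nat.le_succ (n + 1)) (JW (n + 1)))

/-- The Jones–Wenzl recursion for a sequence of elements of an arbitrary `ℚ`-algebra. -/
def jonesWenzlSeq {A : Type*} [Ring A] [Algebra ℚ A] (u : ℕ → A) : ℕ → A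
  | 0 => 1
  | 1 => 1
  | n + 2 => jonesWenzlSeq u (n + 1) -
      (((n : ℚ) + 1) / ((n : ℚ) + 2)) • (jonesWenzlSeq u (n + 1) * u n * jonesWenzlSeq u (n + 1))

/-- The first `N` terms of `u` satisfy the Temperley–Lieb relations with loop parameter `2`. -/
structure IsTLSeq_s9 {A : Type*} [Ring A] (u : ℕ → A) (N : ℕ) : Prop where
  sq : ∀ i < N, u i * u i = 2 * u i
  braid : ∀ i, i + 1 < N → u (i + 1) * u i * u (i + 1) = u (i + 1)
  comm : ∀ i j, i + 1 < j → j < N → Commute (u i) (u j)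

namespace IsTLSeq_s9

variable {A : Type*} [Ring A] [Algebra ℚ A] {u : ℕ → A} {N : ℕ}

theorem commute_jonesWenzlSeq (hu : IsTLSeq_s9 u N) {m j : ℕ} (hmj : m ≤ j) (hj : j < N) :
    Commute (jonesWenzlSeq u m) (u j) := by
  induction m using Nat.twoStepInduction with
  | zero => exact Commute.one_left _
  | one => exact Commute.one_left _
  | more m _ ih =>
    have h := ih (by omega)
    exact h.sub_left (((h.mul_left (hu.comm m j (by omega) hj)).mul_left h).smul_left _)

/-- The partial trace identity `u_m P_{m+1} u_m = ((m+2)/(m+1)) P_m u_m`, given that `P_m` is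
idempotent. -/
theorem mul_jonesWenzlSeq_mul (hu : IsTLSeq_s9 u N) {m : ℕ} (hm : m < N)
    (hP : jonesWenzlSeq u m * jonesWenzlSeq u m = jonesWenzlSeq u m) :
    u m * jonesWenzlSeq u (m + 1) * u m =
      (((m : ℚ) + 2) / ((m : ℚ) + 1)) • (jonesWenzlSeq u m * u m) := by
  cases m with
  | zero => simp [jonesWenzlSeq, hu.sq 0 hm, two_mul, two_smul]
  | succ k =>
    have hc : u (k + 1) * jonesWenzlSeq u (k + 1) = jonesWenzlSeq u (k + 1) * u (k + 1) :=
      (hu.commute_jonesWenzlSeq le_rfl hm).eq.symm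
    have hs := hu.sq (k + 1) hm
    have hb := hu.braid k hm
    rw [jonesWenzlSeq]
    set P := jonesWenzlSeq u (k + 1)
    set v := u (k + 1)
    have h1 : v * P * v = (2 : ℚ) • (P * v) := by
      rw [hc, mul_assoc, hs, two_mul, mul_add, two_smul]
    have h2 : v * (P * u k * P) * v = P * v := by
      calc v * (P * u k * P) * v = (v * P) * u k * (P * v) := by simp only [mul_assoc]
        _ = (P * v) * u k * (v * P) := by rw [hc]
        _ = P * (v * u k * v) * P := by simp only [mul_assoc]
        _ = P * v := by rw [hb, mul_assoc, hc, ← mul_assoc, hP]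
    rw [mul_sub, sub_mul, h1, mul_smul_comm, smul_mul_assoc, h2, ← sub_smul]
    congr 1
    push_cast
    field_simp
    ring

theorem jonesWenzlSeq_spec (hu : IsTLSeq_s9 u N) {m : ℕ} (hm : m ≤ N) :
    jonesWenzlSeq u m * jonesWenzlSeq u m = jonesWenzlSeq u m ∧
    jonesWenzlSeq u (m + 1) * jonesWenzlSeq u (m + 1) = jonesWenzlSeq u (m + 1) ∧
    jonesWenzlSeq u m * jonesWenzlSeq u (m + 1) = jonesWenzlSeq u (m + 1) ∧
    jonesWenzlSeq u (m + 1) * jonesWenzlSeq u m = jonesWenzlSeq u (m + 1) ∧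
    ∀ i < m, u i * jonesWenzlSeq u (m + 1) = 0 ∧ jonesWenzlSeq u (m + 1) * u i = 0 := by
  induction m with
  | zero => simp [jonesWenzlSeq]
  | succ m ih =>
    obtain ⟨hQ, hP, hQP, hPQ, hk⟩ := ih (by omega)
    have hc : jonesWenzlSeq u m * u m = u m * jonesWenzlSeq u m :=
      (hu.commute_jonesWenzlSeq le_rfl hm).eq
    have ht := hu.mul_jonesWenzlSeq_mul hm hQ
    rw [jonesWenzlSeq]
    set P := jonesWenzlSeq u (m + 1)
    set Q := jonesWenzlSeq u m
    have hcd : ((m : ℚ) + 1) / ((m : ℚ) + 2) * (((m : ℚ) + 2) / ((m : ℚ) + 1)) = 1 := by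
      field_simp
    set c := ((m : ℚ) + 1) / ((m : ℚ) + 2)
    set d := ((m : ℚ) + 2) / ((m : ℚ) + 1)
    have hl : P * (P - c • (P * u m * P)) = P - c • (P * u m * P) := by
      rw [mul_sub, mul_smul_comm, ← mul_assoc, ← mul_assoc, hP]
    have hr : (P - c • (P * u m * P)) * P = P - c • (P * u m * P) := by
      rw [sub_mul, smul_mul_assoc, mul_assoc, hP]
    have hul : u m * (P - c • (P * u m * P)) = 0 := by
      have : u m * (P * u m * P) = d • (u m * P) := by
        rw [← mul_assoc, ← mul_assoc, ht, hc, smul_mul_assoc, mul_assoc, hQP]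
      rw [mul_sub, mul_smul_comm, this, smul_smul, hcd, one_smul, sub_self]
    have hur : (P - c • (P * u m * P)) * u m = 0 := by
      have : P * u m * P * u m = d • (P * u m) := by
        rw [mul_assoc, mul_assoc, ← mul_assoc (u m), ht, mul_smul_comm, ← mul_assoc, hPQ]
      rw [sub_mul, smul_mul_assoc, this, smul_smul, hcd, one_smul, sub_self]
    refine ⟨hP, ?_, hl, hr, fun i hi => ?_⟩
    · obtain ⟨X, hX⟩ : ∃ X, X = P - c • (P * u m * P) := ⟨_, rfl⟩
      rw [← hX] at hl hul ⊢
      nth_rewrite 1 [hX]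
      rw [sub_mul, hl, smul_mul_assoc, mul_assoc, hl, mul_assoc, hul, mul_zero, smul_zero, sub_zero]
    · rcases Nat.lt_succ_iff_lt_or_eq.mp hi with h | rfl
      · rw [← hl, ← mul_assoc, (hk i h).1, zero_mul, hl, ← hr, mul_assoc, (hk i h).2, mul_zero]
        exact ⟨rfl, rfl⟩
      · exact ⟨hul, hur⟩

end IsTLSeq_s9

/-- The generators of `TL_n`, extended by zero to a sequence indexed by `ℕ`. -/
noncomputable def TLuSeq (n : ℕ) (i : ℕ) : TL ℚ n :=
  if h : i < n - 1 then TLu ℚ n ⟨i, h⟩ else 0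

theorem TLuSeq_of_lt {n i : ℕ} (h : i < n - 1) : TLuSeq n i = TLu ℚ n ⟨i, h⟩ := dif_pos h

theorem isTLSeq_TLuSeq (n : ℕ) : IsTLSeq_s9 (TLuSeq n) (n - 1) where
  sq i hi := by rw [TLuSeq_of_lt hi]; exact TLu_mul_self ℚ n _
  braid i hi := by
    rw [TLuSeq_of_lt hi, TLuSeq_of_lt (by omega : i < n - 1)]
    exact TLu_braid ℚ n _ _ (by simp [Nat.dist])
  comm i j hij hj := by
    rw [TLuSeq_of_lt hj, TLuSeq_of_lt (by omega : i < n - 1)]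
    exact TLu_comm ℚ n _ _ (by simp only [Nat.dist]; omega)

theorem TLincl_TLu {m n : ℕ} (h : m ≤ n) (i : Fin (m - 1)) :
    TLincl ℚ h (TLu ℚ m i) = TLu ℚ n ⟨i.val, by omega⟩ := by
  simp [TLincl, TLu]

theorem TL_algHom_ext {B : Type*} [Semiring B] [Algebra ℚ B] {n : ℕ} {f g : TL ℚ n →ₐ[ℚ] B}
    (h : ∀ i, f (TLu ℚ n i) = g (TLu ℚ n i)) : f = g :=
  RingQuot.ringQuot_ext' _ _ _ (FreeAlgebra.hom_ext (funext h))

theorem TLincl_TLincl {l m n : ℕ} (h : l ≤ m) (h' : m ≤ n) (x : TL ℚ l) :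
    TLincl ℚ h' (TLincl ℚ h x) = TLincl ℚ (h.trans h') x := by
  have : (TLincl ℚ h').comp (TLincl ℚ h) = TLincl ℚ (h.trans h') :=
    TL_algHom_ext fun i => by simp [TLincl_TLu]
  exact DFunLike.congr_fun this x

theorem TLincl_refl {n : ℕ} (x : TL ℚ n) : TLincl ℚ le_rfl x = x := by
  have : TLincl ℚ (le_refl n) = AlgHom.id ℚ _ := TL_algHom_ext fun i => by simp [TLincl_TLu]
  exact DFunLike.congr_fun this x

theorem TLincl_JW {m n : ℕ} (h : m ≤ n) : TLincl ℚ h (JW m) = jonesWenzlSeq (TLuSeq n) m := by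
  induction m using Nat.twoStepInduction with
  | zero => simp [JW, jonesWenzlSeq]
  | one => simp [JW, jonesWenzlSeq]
  | more m _ ih =>
    rw [JW, jonesWenzlSeq, map_sub, map_smul, map_mul, map_mul, TLincl_TLincl, TLincl_TLu, ih,
      TLuSeq_of_lt (by omega)]

theorem JW_eq_jonesWenzlSeq (n : ℕ) : JW n = jonesWenzlSeq (TLuSeq n) n := by
  rw [← TLincl_JW le_rfl, TLincl_refl]

/-- The augmentation of `TL_n`, sending every generator to zero. -/
noncomputable def TLaug (n : ℕ) : TL ℚ n →ₐ[ℚ] ℚ :=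
  RingQuot.liftAlgHom ℚ
    ⟨FreeAlgebra.lift ℚ (fun _ : Fin (n - 1) => (0 : ℚ)), by
      intro x y hxy
      induction hxy <;> simp⟩

@[simp]
theorem TLaug_TLu (n : ℕ) (i : Fin (n - 1)) : TLaug n (TLu ℚ n i) = 0 := by
  simp [TLaug, TLu]

theorem TLaug_TLuSeq (n i : ℕ) : TLaug n (TLuSeq n i) = 0 := by
  unfold TLuSeq
  split_ifs <;> simp

theorem TLaug_JW (n : ℕ) : TLaug n (JW n) = 1 := by
  have h (m : ℕ) : TLaug n (jonesWenzlSeq (TLuSeq n) m) = 1 := by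
    induction m using Nat.twoStepInduction with
    | zero => simp [jonesWenzlSeq]
    | one => simp [jonesWenzlSeq]
    | more m _ ih => simp [jonesWenzlSeq, ih, TLaug_TLuSeq]
  rw [JW_eq_jonesWenzlSeq, h]

theorem TL_induction {n : ℕ} {p : TL ℚ n → Prop} (algebraMap : ∀ r, p (algebraMap ℚ _ r))
    (gen : ∀ i, p (TLu ℚ n i)) (mul : ∀ a b, p a → p b → p (a * b))
    (add : ∀ a b, p a → p b → p (a + b)) (a : TL ℚ n) : p a := by
  obtain ⟨a, rfl⟩ := RingQuot.mkAlgHom_surjective ℚ (TLRel ℚ n) a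
  induction a using FreeAlgebra.induction with
  | grade0 r => simpa using algebraMap r
  | grade1 i => exact gen i
  | mul a b ha hb => simpa using mul _ _ ha hb
  | add a b ha hb => simpa using add _ _ ha hb

theorem TL_mul_eq_smul {n : ℕ} {x : TL ℚ n} (hx : ∀ i, TLu ℚ n i * x = 0) (a : TL ℚ n) :
    a * x = TLaug n a • x := by
  induction a using TL_induction with
  | algebraMap r => rw [AlgHom.commutes, Algebra.smul_def]; rfl
  | gen i => simp [hx]
  | mul a b ha hb => rw [mul_assoc, hb, mul_smul_comm, ha, smul_smul, map_mul, mul_comm]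
  | add a b ha hb => rw [add_mul, ha, hb, map_add, add_smul]

theorem TL_mul_eq_smul' {n : ℕ} {x : TL ℚ n} (hx : ∀ i, x * TLu ℚ n i = 0) (a : TL ℚ n) :
    x * a = TLaug n a • x := by
  induction a using TL_induction with
  | algebraMap r => rw [AlgHom.commutes, ← Algebra.commutes, Algebra.smul_def]; rfl
  | gen i => simp [hx]
  | mul a b ha hb => rw [← mul_assoc, ha, smul_mul_assoc, hb, smul_smul, map_mul]
  | add a b ha hb => rw [mul_add, ha, hb, map_add, add_smul]

/-- For every `n ≥ 1`, `JW_n` is a nonzero idempotent of `TL_n^ℚ`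
annihilated on both sides by all the generators `u_i`, and it is the unique nonzero
idempotent with this property. -/
theorem JW_isJonesWenzl (n : ℕ) (hn : 1 ≤ n) :
    JW n ≠ 0 ∧ IsIdempotentElem (JW n) ∧
    (∀ i : Fin (n - 1), TLu ℚ n i * JW n = 0 ∧ JW n * TLu ℚ n i = 0) ∧
    (∀ x : TL ℚ n, x ≠ 0 → IsIdempotentElem x →
      (∀ i : Fin (n - 1), TLu ℚ n i * x = 0 ∧ x * TLu ℚ n i = 0) → x = JW n) := by
  obtain ⟨m, rfl⟩ : ∃ m, n = m + 1 := ⟨n - 1, by omega⟩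
  obtain ⟨-, hidem, -, -, hkill⟩ := (isTLSeq_TLuSeq (m + 1)).jonesWenzlSeq_spec (m := m) le_rfl
  rw [← JW_eq_jonesWenzlSeq] at hidem hkill
  have hk (i : Fin (m + 1 - 1)) :
      TLu ℚ (m + 1) i * JW (m + 1) = 0 ∧ JW (m + 1) * TLu ℚ (m + 1) i = 0 := by
    simpa only [TLuSeq_of_lt i.isLt] using hkill i i.isLt
  refine ⟨fun h => ?_, hidem, hk, fun x hx0 hx hxk => ?_⟩
  · simpa [h] using TLaug_JW (m + 1)
  · have hxJW : x = TLaug (m + 1) x • JW (m + 1) := by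
      rw [← TL_mul_eq_smul (fun i => (hk i).1), TL_mul_eq_smul' (fun i => (hxk i).2), TLaug_JW,
        one_smul]
    have hε : IsIdempotentElem (TLaug (m + 1) x) := hx.map (TLaug (m + 1))
    rcases IsIdempotentElem.iff_eq_zero_or_one.mp hε with h | h
    · rw [h, zero_smul] at hxJW
      exact absurd hxJW hx0
    · rwa [h, one_smul] at hxJW
end
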